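/- Let f, g ∈ ℂ[x, y] be squarefree polynomials with f(0) = g(0) = 0, defining complex plane curves V(f), V(g) ⊆ ℂ². If the germs of V(f) and V(g) at the origin are outer bi-Lipschitz homeomorphic, then the multiplicities agree: the least d such that the degree-d homogeneous component of f is nonzero equals the least d such that the degree-d homogeneous component of g is nonzero. -/

import Mathlib

open Filter Topology MvPolynomial

/-- The tangent cone at infinity of a subset `A` of a normed space: `v` is a tangent
vector at infinity if there are points `x i ∈ A` with `‖x i‖ → ∞` and positive reals
`t i` with `x i / t i → v`. -/
def TangentConeAtInfty {E : Type*} [NormedAddCommGroup E] [NormedSpace ℝ E]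
    (A : Set E) : Set E :=
  {v | ∃ (x : ℕ → E) (t : ℕ → ℝ), (∀ i, x i ∈ A) ∧ (∀ i, 0 < t i) ∧
    Tendsto (fun i => ‖x i‖) atTop atTop ∧
    Tendsto (fun i => (t i)⁻¹ • x i) atTop (𝓝 v)}

/-- `X` and `Y` are outer bi-Lipschitz homeomorphic at infinity: there are compact sets
`K`, `K'` and a bijection `φ : X \ K → Y \ K'` which is Lipschitz with Lipschitz inverse,
with respect to the Euclidean (outer) distance. -/
def OuterBiLipAtInfty {E F : Type*} [NormedAddCommGroup E] [NormedAddCommGroup F]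
    (X : Set E) (Y : Set F) : Prop :=
  ∃ (K : Set E) (K' : Set F) (φ : E → F),
    IsCompact K ∧ IsCompact K' ∧ Set.BijOn φ (X \ K) (Y \ K') ∧
    (∃ C > (0:ℝ), ∀ a ∈ X \ K, ∀ b ∈ X \ K, dist (φ a) (φ b) ≤ C * dist a b) ∧
    (∃ c > (0:ℝ), ∀ a ∈ X \ K, ∀ b ∈ X \ K, dist a b ≤ c * dist (φ a) (φ b))

/-- The germs `(X,0)` and `(Y,0)` are outer bi-Lipschitz homeomorphic: there are
`ε, δ > 0` and a bijection `φ : X ∩ B̄_ε(0) → Y ∩ B̄_δ(0)` with `φ 0 = 0` which is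
Lipschitz with Lipschitz inverse for the Euclidean (outer) distance. -/
def OuterBiLipGerm {E F : Type*} [NormedAddCommGroup E] [NormedAddCommGroup F]
    (X : Set E) (Y : Set F) : Prop :=
  ∃ ε > (0:ℝ), ∃ δ > (0:ℝ), ∃ φ : E → F,
    Set.BijOn φ (X ∩ Metric.closedBall 0 ε) (Y ∩ Metric.closedBall 0 δ) ∧ φ 0 = 0 ∧
    (∃ C > (0:ℝ), ∀ a ∈ X ∩ Metric.closedBall 0 ε, ∀ b ∈ X ∩ Metric.closedBall 0 ε,
      dist (φ a) (φ b) ≤ C * dist a b) ∧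
    (∃ c > (0:ℝ), ∀ a ∈ X ∩ Metric.closedBall 0 ε, ∀ b ∈ X ∩ Metric.closedBall 0 ε,
      dist a b ≤ c * dist (φ a) (φ b))

/-- The zero set in `ℂⁿ` (with the Euclidean norm) of a polynomial. -/
noncomputable def mvZeroSet {n : ℕ} (f : MvPolynomial (Fin n) ℂ) :
    Set (EuclideanSpace ℂ (Fin n)) :=
  {x | MvPolynomial.eval (x : Fin n → ℂ) f = 0}

open scoped NNReal

/-- The filter on `ℂ` of neighbourhoods of `Re w = -∞`, on which `Complex.exp` tends to `0`. -/
def leftEnd : Filter ℂ := comap Complex.re atBot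

instance leftEnd_neBot : leftEnd.NeBot :=
  Filter.NeBot.comap_of_surj inferInstance Complex.re_surjective

theorem eventually_leftEnd {P : ℂ → Prop} :
    (∀ᶠ w in leftEnd, P w) ↔ ∃ ρ : ℝ, ∀ w : ℂ, w.re < ρ → P w := by
  have h : leftEnd.HasBasis (fun _ : ℝ => True) fun ρ => Complex.re ⁻¹' Set.Iio ρ :=
    atBot_basis_Iio.comap Complex.re
  simpa using h.eventually_iff

theorem isPreconnected_re_lt (ρ : ℝ) : IsPreconnected {w : ℂ | w.re < ρ} :=
  (convex_halfSpace_re_lt ρ).isPreconnected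

theorem tendsto_leftEnd_iff {α : Type*} {l : Filter α} {u : α → ℂ} :
    Tendsto u l leftEnd ↔ Tendsto (fun a => Complex.exp (u a)) l (𝓝 0) := by
  rw [leftEnd, ← Complex.comap_exp_nhdsNE, tendsto_comap_iff, tendsto_nhdsWithin_iff]
  simp [Function.comp_def, Complex.exp_ne_zero]

theorem tendsto_exp_leftEnd : Tendsto Complex.exp leftEnd (𝓝 0) :=
  tendsto_leftEnd_iff.1 tendsto_id

/-- If finitely many real functions, continuous on a preconnected set, have pairwise disjoint zero
sets covering that set, then only one of them vanishes on it. -/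
theorem IsPreconnected.eq_zero_of_disjoint_zeros {X ι : Type*} [TopologicalSpace X] [Finite ι]
    {S : Set X} (hS : IsPreconnected S) {g : ι → X → ℝ} (hg : ∀ k, ContinuousOn (g k) S)
    (hcov : ∀ s ∈ S, ∃ k, g k s = 0) (hdisj : ∀ s ∈ S, ∀ k l, g k s = 0 → g l s = 0 → k = l)
    {k : ι} {a b : X} (ha : a ∈ S) (hb : b ∈ S) (h : g k a = 0) : g k b = 0 := by
  have : PreconnectedSpace S := isPreconnected_iff_preconnectedSpace.1 hS
  have hclosed : ∀ l, IsClosed {s : S | g l s = 0} := fun l =>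
    isClosed_eq (hg l).domRestrict continuous_const
  have hcompl : {s : S | g k s = 0}ᶜ = ⋃ l : {l // l ≠ k}, {s : S | g l s = 0} := by
    ext s
    simp only [Set.mem_compl_iff, Set.mem_ofPred_eq, Set.mem_iUnion]
    constructor
    · intro hs
      obtain ⟨l, hl⟩ := hcov s s.2
      exact ⟨⟨l, fun e => hs (e ▸ hl)⟩, hl⟩
    · rintro ⟨l, hl⟩ hs
      exact l.2 (hdisj s s.2 _ _ hl hs)
  have hclopen : IsClopen {s : S | g k s = 0} :=
    ⟨hclosed k, isClosed_compl_iff.1 <| by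
      rw [hcompl]; exact isClosed_iUnion_of_finite fun l => hclosed l⟩
  have := hclopen.eq_univ ⟨⟨a, ha⟩, h⟩
  exact (this ▸ Set.mem_univ _ : (⟨b, hb⟩ : S) ∈ {s : S | g k s = 0})

/-- A function continuous near `Re w = -∞` that accumulates only at points of a finite set
converges. -/
theorem exists_tendsto_leftEnd {T : Set ℂ} (hT : T.Finite) {g : ℂ → ℂ} {ρ : ℝ}
    (hg : ContinuousOn g {w | w.re < ρ})
    (h : ∀ ε > 0, ∀ᶠ w in leftEnd, ∃ t ∈ T, ‖g w - t‖ < ε) :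
    ∃ t ∈ T, Tendsto g leftEnd (𝓝 t) := by
  obtain ⟨δ, hsep, hδ⟩ : ∃ δ : ℝ, (∀ t ∈ T, ∀ t' ∈ T, t ≠ t' → 2 * δ < ‖t - t'‖) ∧ 0 < δ := by
    have : ∀ᶠ δ : ℝ in 𝓝[>] 0, ∀ t ∈ T, ∀ t' ∈ T, t ≠ t' → 2 * δ < ‖t - t'‖ := by
      refine (eventually_all_finite hT).2 fun t _ => (eventually_all_finite hT).2 fun t' _ => ?_
      by_cases htt : t = t'
      · simp [htt]
      have hpos : 0 < ‖t - t'‖ / 2 := half_pos (norm_pos_iff.2 (sub_ne_zero.2 htt))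
      filter_upwards [nhdsWithin_le_nhds (Iio_mem_nhds hpos)] with δ hδ _
      have : δ < ‖t - t'‖ / 2 := hδ
      linarith
    exact (this.and self_mem_nhdsWithin).exists
  have huniq : ∀ {w t t'}, t ∈ T → t' ∈ T → ‖g w - t‖ ≤ δ → ‖g w - t'‖ ≤ δ → t = t' := by
    intro w t t' ht ht' h1 h2
    by_contra hne
    have h3 := hsep t ht t' ht' hne
    have : ‖t - t'‖ ≤ ‖g w - t'‖ + ‖g w - t‖ := by
      rw [show t - t' = (g w - t') - (g w - t) by ring]; exact norm_sub_le _ _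
    linarith
  obtain ⟨ρ', hρ'⟩ := eventually_leftEnd.1 (h δ hδ)
  have hSpre := isPreconnected_re_lt (min ρ ρ')
  set S := {w : ℂ | w.re < min ρ ρ'} with hSdef
  have hSL : S ∈ leftEnd := eventually_leftEnd.2 ⟨_, fun w hw => hw⟩
  obtain ⟨a, ha⟩ := leftEnd_neBot.nonempty_of_mem hSL
  have hnear : ∀ s ∈ S, ∃ t ∈ T, ‖g s - t‖ < δ := fun s hs => hρ' s (hs.trans_le (min_le_right _ _))
  obtain ⟨t, ht, hta⟩ := hnear a ha
  have hzero : ∀ (s u : ℂ), max (‖g s - u‖ - δ) 0 = 0 ↔ ‖g s - u‖ ≤ δ := by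
    intro s u; rw [max_eq_right_iff, sub_nonpos]
  have hall : ∀ s ∈ S, ‖g s - t‖ ≤ δ := by
    intro s hs
    have : Finite T := hT
    refine (hzero _ _).1 (hSpre.eq_zero_of_disjoint_zeros (ι := T)
      (g := fun u s => max (‖g s - u‖ - δ) 0) (fun u => ?_) ?_ ?_ ha hs (k := ⟨t, ht⟩)
      ((hzero _ _).2 hta.le))
    · have : ContinuousOn g S := hg.mono fun s hs =>
        lt_of_lt_of_le (b := min ρ ρ') hs (min_le_left _ _)
      fun_prop
    · intro s hs
      obtain ⟨u, hu, hus⟩ := hnear s hs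
      exact ⟨⟨u, hu⟩, (hzero _ _).2 hus.le⟩
    · intro s _ k l hk hl
      exact Subtype.ext (huniq k.2 l.2 ((hzero _ _).1 hk) ((hzero _ _).1 hl))
  refine ⟨t, ht, Metric.tendsto_nhds.2 fun ε hε => ?_⟩
  filter_upwards [hSL, h _ (lt_min hε hδ)] with w hwS hw
  obtain ⟨u, hu, hwu⟩ := hw
  obtain rfl := huniq hu ht (hwu.le.trans (min_le_right _ _)) (hall w hwS)
  rw [dist_eq_norm]
  exact hwu.trans_le (min_le_left _ _)

section Sheeted

/-- The point of slope `z` over `exp w`. -/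
noncomputable def slopePoint (z : ℂ → ℂ) (w : ℂ) : ℂ × ℂ := (Complex.exp w, Complex.exp w * z w)

/-- Near the origin, `A \ {0}` is the union of the disjoint sheets
`{(exp w, exp w * Z i w)}`, whose slopes `Z i` have limits `t i` at the origin. -/
structure IsSheeted {ι : Type*} (A : Set (ℂ × ℂ)) (Z : ι → ℂ → ℂ) (t : ι → ℂ) : Prop where
  continuousOn : ∃ ρ : ℝ, ∀ i, ContinuousOn (Z i) {w | w.re < ρ}
  injective : ∀ᶠ w in leftEnd, Function.Injective fun i => Z i w
  tendsto : ∀ i, Tendsto (Z i) leftEnd (𝓝 (t i))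
  mem : ∀ i, ∀ᶠ w in leftEnd, slopePoint (Z i) w ∈ A
  exists_eq : ∀ᶠ p in 𝓝[A \ {0}] 0,
    p.1 ≠ 0 ∧ ∀ w, Complex.exp w = p.1 → ∃ i, p = slopePoint (Z i) w

/-- `φ : A → B` and `ψ : B → A` are mutually inverse Lipschitz maps preserving the origin. -/
structure LipschitzInverses (A B : Set (ℂ × ℂ)) (φ ψ : ℂ × ℂ → ℂ × ℂ) (C : ℝ≥0) : Prop where
  mapsTo_left : Set.MapsTo φ A B
  mapsTo_right : Set.MapsTo ψ B A
  left_inv : ∀ a ∈ A, ψ (φ a) = a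
  right_inv : ∀ b ∈ B, φ (ψ b) = b
  zero_mem : (0 : ℂ × ℂ) ∈ A
  map_zero : φ 0 = 0
  lipschitz_left : LipschitzOnWith C φ A
  lipschitz_right : LipschitzOnWith C ψ B

variable {ι κ : Type*} {A B : Set (ℂ × ℂ)} {Z : ι → ℂ → ℂ} {t : ι → ℂ} {Z' : κ → ℂ → ℂ}
  {t' : κ → ℂ} {φ ψ : ℂ × ℂ → ℂ × ℂ} {C : ℝ≥0}

theorem slopePoint_ne_zero (z : ℂ → ℂ) (w : ℂ) : slopePoint z w ≠ 0 := fun h =>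
  Complex.exp_ne_zero w (congrArg Prod.fst h)

theorem slopePoint_slope (z : ℂ → ℂ) (w : ℂ) :
    (slopePoint z w).2 / (slopePoint z w).1 = z w := by
  simp [slopePoint, Complex.exp_ne_zero]

theorem norm_exp_le_norm_slopePoint (z : ℂ → ℂ) (w : ℂ) :
    ‖Complex.exp w‖ ≤ ‖slopePoint z w‖ := norm_fst_le (slopePoint z w)

theorem norm_slopePoint_sub_le (z z' : ℂ → ℂ) (w : ℂ) :
    ‖slopePoint z w - slopePoint z' w‖ ≤ ‖Complex.exp w‖ * ‖z w - z' w‖ := by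
  simp [slopePoint, Prod.norm_def, ← mul_sub]

namespace LipschitzInverses

theorem symm (h : LipschitzInverses A B φ ψ C) : LipschitzInverses B A ψ φ C where
  mapsTo_left := h.mapsTo_right
  mapsTo_right := h.mapsTo_left
  left_inv := h.right_inv
  right_inv := h.left_inv
  zero_mem := h.map_zero ▸ h.mapsTo_left h.zero_mem
  map_zero := by simpa [h.map_zero] using h.left_inv 0 h.zero_mem
  lipschitz_left := h.lipschitz_right
  lipschitz_right := h.lipschitz_left

theorem norm_le (h : LipschitzInverses A B φ ψ C) {p : ℂ × ℂ} (hp : p ∈ A) :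
    ‖φ p‖ ≤ C * ‖p‖ := by
  simpa [h.map_zero] using h.lipschitz_left.dist_le_mul p hp 0 h.zero_mem

theorem le_norm (h : LipschitzInverses A B φ ψ C) {p : ℂ × ℂ} (hp : p ∈ A) :
    ‖p‖ ≤ C * ‖φ p‖ := by
  simpa [h.left_inv p hp] using h.symm.norm_le (h.mapsTo_left hp)

theorem tendsto (h : LipschitzInverses A B φ ψ C) :
    Tendsto φ (𝓝[A \ {0}] 0) (𝓝[B \ {0}] 0) := by
  refine tendsto_nhdsWithin_iff.2 ⟨?_, ?_⟩
  · have := h.lipschitz_left.continuousOn 0 h.zero_mem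
    rw [ContinuousWithinAt, h.map_zero] at this
    exact this.mono_left (nhdsWithin_mono _ Set.sdiff_subset)
  · filter_upwards [self_mem_nhdsWithin] with p hp
    refine ⟨h.mapsTo_left hp.1, fun h0 => hp.2 ?_⟩
    have h1 := h.left_inv p hp.1
    rw [Set.mem_singleton_iff.1 h0, h.symm.map_zero] at h1
    exact h1.symm

end LipschitzInverses

namespace IsSheeted

theorem tendsto_slopePoint (h : IsSheeted A Z t) (i : ι) :
    Tendsto (slopePoint (Z i)) leftEnd (𝓝[A \ {0}] 0) := by
  refine tendsto_nhdsWithin_iff.2 ⟨?_, ?_⟩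
  · have h1 := tendsto_exp_leftEnd.mul (h.tendsto i)
    rw [zero_mul] at h1
    exact tendsto_exp_leftEnd.prodMk_nhds h1
  · filter_upwards [h.mem i] with w hw
    exact ⟨hw, slopePoint_ne_zero _ _⟩

theorem eventually_fst_ne_zero (h : IsSheeted A Z t) : ∀ᶠ p in 𝓝[A \ {0}] 0, p.1 ≠ 0 :=
  h.exists_eq.mono fun _ hp => hp.1

theorem tendsto_log_fst (h : IsSheeted A Z t) :
    Tendsto (fun p : ℂ × ℂ => Complex.log p.1) (𝓝[A \ {0}] 0) leftEnd := by
  rw [tendsto_leftEnd_iff]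
  have : Tendsto (fun p : ℂ × ℂ => p.1) (𝓝[A \ {0}] 0) (𝓝 0) :=
    (continuous_fst.tendsto (0 : ℂ × ℂ)).mono_left nhdsWithin_le_nhds
  refine this.congr' ?_
  filter_upwards [h.eventually_fst_ne_zero] with p hp
  rw [Complex.exp_log hp]

theorem eventually_exists_eq (h : IsSheeted A Z t) {P : ℂ → Prop} (hP : ∀ᶠ w in leftEnd, P w) :
    ∀ᶠ p in 𝓝[A \ {0}] 0, ∃ i, ∃ w, P w ∧ p = slopePoint (Z i) w := by
  filter_upwards [h.exists_eq, h.tendsto_log_fst.eventually hP] with p hp hw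
  obtain ⟨i, hi⟩ := hp.2 _ (Complex.exp_log hp.1)
  exact ⟨i, _, hw, hi⟩

theorem exists_norm_slope_le [Finite ι] (h : IsSheeted A Z t) :
    ∃ M : ℝ, 0 < M ∧ ∀ᶠ w in leftEnd, ∀ i, ‖Z i w‖ ≤ M := by
  have : Fintype ι := Fintype.ofFinite ι
  refine ⟨∑ i, ‖t i‖ + 1, by positivity, eventually_all.2 fun i => ?_⟩
  have h1 : ‖t i‖ < ∑ i, ‖t i‖ + 1 :=
    (Finset.single_le_sum (fun i _ => norm_nonneg (t i)) (Finset.mem_univ i)).trans_lt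
      (lt_add_one _)
  exact ((h.tendsto i).norm.eventually_lt_const h1).mono fun _ => le_of_lt

/-- Near the origin the norm of a point is controlled by its first coordinate. -/
theorem exists_norm_le [Finite ι] (h : IsSheeted A Z t) :
    ∃ M : ℝ, 0 < M ∧ ∀ᶠ p in 𝓝[A \ {0}] 0, ‖p‖ ≤ M * ‖p.1‖ := by
  obtain ⟨M, hM, hZ⟩ := h.exists_norm_slope_le
  refine ⟨max 1 M, by positivity, ?_⟩
  filter_upwards [h.eventually_exists_eq hZ] with p hp
  obtain ⟨i, w, hw, rfl⟩ := hp
  rw [Prod.norm_def]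
  refine max_le (le_mul_of_one_le_left (norm_nonneg _) (le_max_left _ _)) ?_
  simp only [slopePoint, norm_mul]
  rw [mul_comm]
  gcongr
  exact (hw i).trans (le_max_right _ _)

end IsSheeted

theorem norm_slope_sub_le {M : ℝ} {p q : ℂ × ℂ} (hp : p.1 ≠ 0) (hq : q.1 ≠ 0)
    (hMp : ‖p‖ ≤ M * ‖p.1‖) (hMq : ‖q‖ ≤ M * ‖q.1‖) :
    ‖p.2 / p.1 - q.2 / q.1‖ ≤ (1 + M) * M * (‖p - q‖ / ‖p‖) := by
  have hp1 : 0 < ‖p.1‖ := norm_pos_iff.2 hp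
  have hq1 : 0 < ‖q.1‖ := norm_pos_iff.2 hq
  have hp0 : 0 < ‖p‖ := hp1.trans_le (norm_fst_le p)
  have hM : 0 < M := pos_of_mul_pos_left (hp0.trans_le hMp) hp1.le
  have hs : ‖q.2 / q.1‖ ≤ M := by
    rw [norm_div, div_le_iff₀ hq1]
    exact (norm_snd_le q).trans hMq
  have h1 : p.2 / p.1 - q.2 / q.1 = ((p - q).2 - (p - q).1 * (q.2 / q.1)) / p.1 := by
    simp only [Prod.fst_sub, Prod.snd_sub]
    field_simp
    ring
  have h2 : ‖(p - q).2 - (p - q).1 * (q.2 / q.1)‖ ≤ (1 + M) * ‖p - q‖ := by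
    refine (norm_sub_le _ _).trans ?_
    rw [norm_mul, add_mul, one_mul, mul_comm M]
    gcongr
    · exact norm_snd_le _
    · exact norm_fst_le _
  rw [h1, norm_div, ← mul_div_mul_left _ _ hM.ne']
  calc M * ‖(p - q).2 - (p - q).1 * (q.2 / q.1)‖ / (M * ‖p.1‖)
      ≤ M * ((1 + M) * ‖p - q‖) / ‖p‖ := by gcongr
    _ = (1 + M) * M * (‖p - q‖ / ‖p‖) := by ring

namespace IsSheeted

theorem tendsto_map_slopePoint (hA : IsSheeted A Z t) (h : LipschitzInverses A B φ ψ C) (i : ι) :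
    Tendsto (fun w => φ (slopePoint (Z i) w)) leftEnd (𝓝[B \ {0}] 0) :=
  h.tendsto.comp (hA.tendsto_slopePoint i)

/-- The image of a sheet has a limit slope. -/
theorem exists_tendsto_slope_map [Finite κ] (hA : IsSheeted A Z t) (hB : IsSheeted B Z' t')
    (h : LipschitzInverses A B φ ψ C) (i : ι) :
    ∃ s, Tendsto (fun w => (φ (slopePoint (Z i) w)).2 / (φ (slopePoint (Z i) w)).1)
      leftEnd (𝓝 s) := by
  have hT := hA.tendsto_map_slopePoint h i
  obtain ⟨ρ, hρ⟩ := hA.continuousOn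
  obtain ⟨ρ', hρ'⟩ := eventually_leftEnd.1 ((hA.mem i).and
    (hT.eventually hB.eventually_fst_ne_zero))
  have hcont : ContinuousOn (fun w => φ (slopePoint (Z i) w)) {w | w.re < min ρ ρ'} := by
    refine h.lipschitz_left.continuousOn.comp ?_ fun w hw =>
      (hρ' w (lt_of_lt_of_le (b := min ρ ρ') hw (min_le_right _ _))).1
    have : ContinuousOn (Z i) {w | w.re < min ρ ρ'} :=
      (hρ i).mono fun s hs => lt_of_lt_of_le (b := min ρ ρ') hs (min_le_left _ _)
    unfold slopePoint
    fun_prop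
  have hacc : ∀ ε > 0, ∀ᶠ w in leftEnd, ∃ s ∈ Set.range t',
      ‖(φ (slopePoint (Z i) w)).2 / (φ (slopePoint (Z i) w)).1 - s‖ < ε := by
    intro ε hε
    have hZ : ∀ᶠ w in leftEnd, ∀ j, ‖Z' j w - t' j‖ < ε := eventually_all.2 fun j => by
      simpa [dist_eq_norm] using Metric.tendsto_nhds.1 (hB.tendsto j) ε hε
    filter_upwards [hT.eventually (hB.eventually_exists_eq hZ)] with w hw
    obtain ⟨j, v, hv, hj⟩ := hw
    exact ⟨t' j, ⟨j, rfl⟩, by rw [hj, slopePoint_slope]; exact hv j⟩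
  obtain ⟨s, -, hs⟩ := exists_tendsto_leftEnd (Set.finite_range t') (ρ := min ρ ρ')
    (hcont.snd.div hcont.fst fun w hw =>
      (hρ' w (lt_of_lt_of_le (b := min ρ ρ') hw (min_le_right _ _))).2) hacc
  exact ⟨s, hs⟩

/-- Sheets with the same limit slope have images that are close relatively to the distance to the
origin. -/
theorem tendsto_norm_map_sub_div (hA : IsSheeted A Z t) (h : LipschitzInverses A B φ ψ C)
    {i l : ι} (hil : t i = t l) :
    Tendsto (fun w => ‖φ (slopePoint (Z i) w) - φ (slopePoint (Z l) w)‖ /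
      ‖φ (slopePoint (Z i) w)‖) leftEnd (𝓝 0) := by
  have hlim : Tendsto (fun w => C * C * ‖Z i w - Z l w‖) leftEnd (𝓝 0) := by
    have := (((hA.tendsto i).sub (hA.tendsto l)).norm).const_mul ((C : ℝ) * C)
    simpa [hil] using this
  refine squeeze_zero' (Eventually.of_forall fun w => by positivity) ?_ hlim
  filter_upwards [hA.mem i, hA.mem l] with w hi hl
  have h1 := h.lipschitz_left.dist_le_mul _ hi _ hl
  rw [dist_eq_norm, dist_eq_norm] at h1
  have h2 := norm_slopePoint_sub_le (Z i) (Z l) w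
  have h3 := (norm_exp_le_norm_slopePoint (Z i) w).trans (h.le_norm hi)
  have hE : 0 < ‖Complex.exp w‖ := norm_pos_iff.2 (Complex.exp_ne_zero w)
  have hpos : 0 < ‖φ (slopePoint (Z i) w)‖ :=
    pos_of_mul_pos_right (hE.trans_le h3) C.2
  rw [div_le_iff₀ hpos]
  calc _ ≤ C * (‖Complex.exp w‖ * ‖Z i w - Z l w‖) := h1.trans (by gcongr)
    _ ≤ C * ((C * ‖φ (slopePoint (Z i) w)‖) * ‖Z i w - Z l w‖) := by gcongr
    _ = _ := by ring

theorem limit_slope_map_eq [Finite κ] (hA : IsSheeted A Z t) (hB : IsSheeted B Z' t')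
    (h : LipschitzInverses A B φ ψ C) {σ : ι → ℂ}
    (hσ : ∀ i, Tendsto (fun w => (φ (slopePoint (Z i) w)).2 / (φ (slopePoint (Z i) w)).1)
      leftEnd (𝓝 (σ i))) {i l : ι} (hil : t i = t l) : σ i = σ l := by
  obtain ⟨M, -, hM⟩ := hB.exists_norm_le
  have hi := hA.tendsto_map_slopePoint h i
  have hl := hA.tendsto_map_slopePoint h l
  have hlim := (hA.tendsto_norm_map_sub_div h hil).const_mul ((1 + M) * M)
  rw [mul_zero] at hlim
  have h0 := squeeze_zero_norm' ?_ hlim (f := fun w =>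
    (φ (slopePoint (Z i) w)).2 / (φ (slopePoint (Z i) w)).1 -
      (φ (slopePoint (Z l) w)).2 / (φ (slopePoint (Z l) w)).1)
  · exact sub_eq_zero.1 (tendsto_nhds_unique ((hσ i).sub (hσ l)) h0)
  filter_upwards [hi.eventually hM, hl.eventually hM, hi.eventually hB.eventually_fst_ne_zero,
    hl.eventually hB.eventually_fst_ne_zero] with w h1 h2 h3 h4
  exact norm_slope_sub_le h3 h4 h1 h2

/-- The limit slopes of the images of two sheets agree only if those of the sheets do. -/
theorem limit_slope_map_injective [Finite ι] [Finite κ] (hA : IsSheeted A Z t)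
    (hB : IsSheeted B Z' t') (h : LipschitzInverses A B φ ψ C) {σ : ι → ℂ}
    (hσ : ∀ i, Tendsto (fun w => (φ (slopePoint (Z i) w)).2 / (φ (slopePoint (Z i) w)).1)
      leftEnd (𝓝 (σ i))) {i l : ι} (hil : σ i = σ l) : t i = t l := by
  choose σ' hσ' using hB.exists_tendsto_slope_map hA h.symm
  have key : ∀ i, ∃ j, t' j = σ i ∧ σ' j = t i := by
    intro i
    have hT := hA.tendsto_map_slopePoint h i
    have hlog : Tendsto (fun w => Complex.log (φ (slopePoint (Z i) w)).1) leftEnd leftEnd :=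
      hB.tendsto_log_fst.comp hT
    have hex : ∀ᶠ w in leftEnd, ∃ j, φ (slopePoint (Z i) w) =
        slopePoint (Z' j) (Complex.log (φ (slopePoint (Z i) w)).1) := by
      filter_upwards [hT.eventually hB.exists_eq] with w hw
      exact hw.2 _ (Complex.exp_log hw.1)
    obtain ⟨j, hj⟩ : ∃ j, ∃ᶠ w in leftEnd, φ (slopePoint (Z i) w) =
        slopePoint (Z' j) (Complex.log (φ (slopePoint (Z i) w)).1) := by
      by_contra! hne
      obtain ⟨w, ⟨j, hw⟩, hw'⟩ := (hex.and (eventually_all.2 hne)).exists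
      exact hw' j hw
    refine ⟨j, ?_, ?_⟩
    · refine tendsto_nhds_unique_of_frequently_eq ((hB.tendsto j).comp hlog) (hσ i) ?_
      refine hj.mono fun w hw => ?_
      conv_rhs => rw [hw, slopePoint_slope]
      rfl
    · refine tendsto_nhds_unique_of_frequently_eq ((hσ' j).comp hlog) (hA.tendsto i) ?_
      refine (hj.and_eventually (hA.mem i)).mono fun w hw => ?_
      simp only [Function.comp_apply]
      rw [← hw.1, h.left_inv _ hw.2, slopePoint_slope]
  obtain ⟨j, hj, hj'⟩ := key i
  obtain ⟨k, hk, hk'⟩ := key l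
  rw [← hj', ← hk']
  exact hB.limit_slope_map_eq hA h.symm hσ' (by rw [hj, hk, hil])

/-- A short path in `A` cannot join two sheets. -/
theorem eventually_eq_of_path [Finite ι] (hA : IsSheeted A Z t) :
    ∀ᶠ w in leftEnd, ∀ (i l : ι) (γ : ℝ → ℂ × ℂ), ContinuousOn γ (Set.Icc 0 1) →
      (∀ θ ∈ Set.Icc (0 : ℝ) 1, γ θ ∈ A) →
      (∀ θ ∈ Set.Icc (0 : ℝ) 1, ‖γ θ - γ 0‖ ≤ ‖Complex.exp w‖ / 2) →
      γ 0 = slopePoint (Z i) w → γ 1 = slopePoint (Z l) w → i = l := by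
  obtain ⟨r, hr, hcov⟩ := Metric.mem_nhdsWithin_iff.1 hA.exists_eq
  obtain ⟨ρ, hρ⟩ := hA.continuousOn
  obtain ⟨ρ', hinj⟩ := eventually_leftEnd.1 hA.injective
  have hsmall : ∀ i, ∀ᶠ w in leftEnd, ‖slopePoint (Z i) w‖ + ‖Complex.exp w‖ / 2 < r := by
    intro i
    have h1 := ((tendsto_nhds_of_tendsto_nhdsWithin (hA.tendsto_slopePoint i)).norm).add
      (tendsto_exp_leftEnd.norm.div_const 2)
    exact h1.eventually_lt_const (by simpa using hr)
  filter_upwards [eventually_all.2 hsmall,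
    eventually_leftEnd.2 ⟨min ρ ρ' - 1, fun w hw => hw⟩] with w hw hre
  intro i l γ hγ hγA hγd h0 h1
  have hE : 0 < ‖Complex.exp w‖ := norm_pos_iff.2 (Complex.exp_ne_zero w)
  have hratio : ∀ θ ∈ Set.Icc (0 : ℝ) 1, ‖(γ θ).1 / Complex.exp w - 1‖ ≤ 1 / 2 := by
    intro θ hθ
    have h2 := (norm_fst_le (γ θ - γ 0)).trans (hγd θ hθ)
    have h3 : (γ θ).1 / Complex.exp w - 1 = (γ θ - γ 0).1 / Complex.exp w := by
      rw [Prod.fst_sub, h0, slopePoint, sub_div, div_self (Complex.exp_ne_zero w)]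
    rw [h3, norm_div, div_le_iff₀ hE]
    linarith
  have hslit : ∀ θ ∈ Set.Icc (0 : ℝ) 1, (γ θ).1 / Complex.exp w ∈ Complex.slitPlane := by
    intro θ hθ
    have h2 := Complex.mem_slitPlane_of_norm_lt_one
      ((hratio θ hθ).trans_lt (by norm_num : (1 / 2 : ℝ) < 1))
    simpa using h2
  set u : ℝ → ℂ := fun θ => w + Complex.log ((γ θ).1 / Complex.exp w) with hu
  have hexpu : ∀ θ ∈ Set.Icc (0 : ℝ) 1, Complex.exp (u θ) = (γ θ).1 := by
    intro θ hθ
    rw [hu, Complex.exp_add, Complex.exp_log (Complex.slitPlane_ne_zero (hslit θ hθ))]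
    field_simp
  have hfst : ∀ θ ∈ Set.Icc (0 : ℝ) 1, (γ θ).1 ≠ 0 := fun θ hθ =>
    hexpu θ hθ ▸ Complex.exp_ne_zero _
  have hure : ∀ θ ∈ Set.Icc (0 : ℝ) 1, (u θ).re < min ρ ρ' := by
    intro θ hθ
    have hpos := norm_pos_iff.2 (Complex.slitPlane_ne_zero (hslit θ hθ))
    have h2 := Real.log_le_sub_one_of_pos hpos
    have h3 := norm_le_norm_sub_add ((γ θ).1 / Complex.exp w) 1
    have h4 := hratio θ hθ
    simp only [norm_one] at h3
    simp only [hu, Complex.add_re, Complex.log_re]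
    linarith
  have hucont : ContinuousOn u (Set.Icc 0 1) :=
    continuousOn_const.add ((hγ.fst.div_const _).clog hslit)
  have hlift : ∀ θ ∈ Set.Icc (0 : ℝ) 1, ∃ k, γ θ = slopePoint (Z k) (u θ) := by
    intro θ hθ
    refine (hcov ⟨?_, hγA θ hθ, ?_⟩).2 _ (hexpu θ hθ)
    · rw [mem_ball_zero_iff]
      have h2 := norm_le_norm_sub_add (γ θ) (γ 0)
      have h3 := hγd θ hθ
      rw [h0] at h2 h3
      linarith [hw i]
    · exact fun h => hfst θ hθ (congrArg Prod.fst h)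
  have hzero : ∀ θ ∈ Set.Icc (0 : ℝ) 1, ∀ k, γ θ = slopePoint (Z k) (u θ) →
      ‖(γ θ).2 / (γ θ).1 - Z k (u θ)‖ = 0 := by
    intro θ _ k hk
    rw [hk, slopePoint_slope, sub_self, norm_zero]
  have hdisj : ∀ θ ∈ Set.Icc (0 : ℝ) 1, ∀ k k', ‖(γ θ).2 / (γ θ).1 - Z k (u θ)‖ = 0 →
      ‖(γ θ).2 / (γ θ).1 - Z k' (u θ)‖ = 0 → k = k' := by
    intro θ hθ k k' hk hk'
    rw [norm_eq_zero, sub_eq_zero] at hk hk'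
    exact hinj (u θ) ((hure θ hθ).trans_le (min_le_right _ _)) (hk.symm.trans hk')
  have hu_eq : ∀ k, ∀ θ ∈ Set.Icc (0 : ℝ) 1, γ θ = slopePoint (Z k) w → u θ = w := by
    intro k θ _ hθ
    simp [hu, hθ, slopePoint, Complex.exp_ne_zero]
  have m0 : (0 : ℝ) ∈ Set.Icc (0 : ℝ) 1 := by simp
  have m1 : (1 : ℝ) ∈ Set.Icc (0 : ℝ) 1 := by simp
  refine hdisj 1 m1 i l ?_ (hzero 1 m1 l (by rw [hu_eq l 1 m1 h1]; exact h1))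
  refine isPreconnected_Icc.eq_zero_of_disjoint_zeros
    (g := fun k θ => ‖(γ θ).2 / (γ θ).1 - Z k (u θ)‖) (fun k => ?_) ?_ hdisj m0 m1
    (hzero 0 m0 i (by rw [hu_eq i 0 m0 h0]; exact h0))
  · refine ((hγ.snd.div hγ.fst hfst).sub ((hρ k).comp hucont fun θ hθ => ?_)).norm
    exact (hure θ hθ).trans_le (min_le_left _ _)
  · intro θ hθ
    obtain ⟨k, hk⟩ := hlift θ hθ
    exact ⟨k, hzero θ hθ k hk⟩

/-- Sheets vary slowly, relatively to the distance to the origin. -/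
theorem exists_norm_slopePoint_sub_le [Finite ι] (hA : IsSheeted A Z t) {ε : ℝ} (hε : 0 < ε) :
    ∃ δ > 0, ∀ᶠ w in leftEnd, ∀ i, ∀ v, ‖v - w‖ < δ →
      ‖slopePoint (Z i) v - slopePoint (Z i) w‖ ≤ ε * ‖Complex.exp w‖ := by
  obtain ⟨M, hM, hZ⟩ := hA.exists_norm_slope_le
  have hexp : ∀ᶠ x in 𝓝 (0 : ℂ), ‖Complex.exp x - 1‖ < min ε (ε / (2 * M)) := by
    have h1 : Tendsto (fun x : ℂ => ‖Complex.exp x - 1‖) (𝓝 0) (𝓝 0) := by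
      have : Continuous fun x : ℂ => ‖Complex.exp x - 1‖ := by fun_prop
      simpa using this.tendsto 0
    exact h1.eventually_lt_const (by positivity)
  obtain ⟨δ, hδ, hexp⟩ := Metric.eventually_nhds_iff.1 hexp
  have hclose : ∀ᶠ w in leftEnd, ∀ i, ‖Z i w - t i‖ < ε / 4 := eventually_all.2 fun i => by
    simpa [dist_eq_norm] using Metric.tendsto_nhds.1 (hA.tendsto i) (ε / 4) (by positivity)
  obtain ⟨ρ, hρ⟩ := eventually_leftEnd.1 (hZ.and hclose)
  refine ⟨δ, hδ, eventually_leftEnd.2 ⟨ρ - δ, fun w hw i v hv => ?_⟩⟩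
  have hvρ : v.re < ρ := by
    have h1 := (Complex.re_le_norm (v - w)).trans_lt hv
    rw [Complex.sub_re] at h1
    linarith
  obtain ⟨hMv, hcv⟩ := hρ v hvρ
  have hcw := (hρ w (by linarith)).2
  have he := hexp (y := v - w) (by simpa [dist_eq_norm] using hv)
  have hev : Complex.exp v = Complex.exp w * Complex.exp (v - w) := by
    rw [← Complex.exp_add]; congr 1; ring
  have h1 : Complex.exp v - Complex.exp w = Complex.exp w * (Complex.exp (v - w) - 1) := by
    rw [hev]; ring
  have h2 : Complex.exp v * Z i v - Complex.exp w * Z i w =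
      Complex.exp w * ((Complex.exp (v - w) - 1) * Z i v + ((Z i v - t i) - (Z i w - t i))) := by
    rw [hev]; ring
  have h3 : ‖(Complex.exp (v - w) - 1) * Z i v + ((Z i v - t i) - (Z i w - t i))‖ ≤ ε := by
    have h4 : ‖(Complex.exp (v - w) - 1) * Z i v‖ ≤ ε / (2 * M) * M := by
      rw [norm_mul]
      gcongr
      · exact he.le.trans (min_le_right _ _)
      · exact hMv i
    have h5 : ε / (2 * M) * M = ε / 2 := by field_simp
    have h6 := norm_sub_le (Z i v - t i) (Z i w - t i)
    refine (norm_add_le _ _).trans ?_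
    linarith [hcv i, hcw i]
  rw [Prod.norm_def]
  refine max_le ?_ ?_
  · simp only [slopePoint, Prod.fst_sub]
    rw [h1, norm_mul, mul_comm]
    gcongr
    exact he.le.trans (min_le_left _ _)
  · simp only [slopePoint, Prod.snd_sub]
    rw [h2, norm_mul, mul_comm]
    gcongr

/-- Sheets whose images meet a common sheet in nearby points coincide. -/
theorem eq_of_frequently_map_eq [Finite ι] [Finite κ] (hA : IsSheeted A Z t)
    (hB : IsSheeted B Z' t') (h : LipschitzInverses A B φ ψ C) {i l : ι} {j : κ} {v v' : ℂ → ℂ}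
    (hv : Tendsto v leftEnd leftEnd) (hvv' : Tendsto (fun w => v' w - v w) leftEnd (𝓝 0))
    (hfreq : ∃ᶠ w in leftEnd, φ (slopePoint (Z i) w) = slopePoint (Z' j) (v w) ∧
      φ (slopePoint (Z l) w) = slopePoint (Z' j) (v' w)) : i = l := by
  obtain ⟨M, hM, hMA⟩ := hA.exists_norm_le
  obtain ⟨δ, hδ, hδB⟩ := hB.exists_norm_slopePoint_sub_le
    (ε := 1 / (2 * (C * C * M + 1))) (by positivity)
  obtain ⟨ρ₁, hcont⟩ := hB.continuousOn
  obtain ⟨ρ₂, hmem⟩ := eventually_leftEnd.1 (hB.mem j)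
  have hδv : ∀ᶠ w in leftEnd, ‖v' w - v w‖ < δ := by
    simpa using Metric.tendsto_nhds.1 hvv' δ hδ
  have hre : ∀ᶠ w in leftEnd, (v w).re < min ρ₁ ρ₂ - δ :=
    hv.eventually (eventually_leftEnd.2 ⟨_, fun w hw => hw⟩)
  obtain ⟨w, ⟨hi, hl⟩, hpath, hw, hδw, hrew, hmi, hml, hMi⟩ := (hfreq.and_eventually
    (hA.eventually_eq_of_path.and <| (hv.eventually hδB).and <| hδv.and <| hre.and <|
      (hA.mem i).and <| (hA.mem l).and ((hA.tendsto_slopePoint i).eventually hMA))).exists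
  set x : ℝ → ℂ := fun θ => v w + θ * (v' w - v w) with hx
  have hxδ : ∀ θ ∈ Set.Icc (0 : ℝ) 1, ‖x θ - v w‖ < δ := by
    intro θ hθ
    rw [hx, add_sub_cancel_left, norm_mul, Complex.norm_real, Real.norm_of_nonneg hθ.1]
    exact (mul_le_of_le_one_left (norm_nonneg _) hθ.2).trans_lt hδw
  have hxre : ∀ θ ∈ Set.Icc (0 : ℝ) 1, (x θ).re < min ρ₁ ρ₂ := by
    intro θ hθ
    have h1 := (Complex.re_le_norm (x θ - v w)).trans_lt (hxδ θ hθ)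
    rw [Complex.sub_re] at h1
    linarith
  have hxB : ∀ θ ∈ Set.Icc (0 : ℝ) 1, slopePoint (Z' j) (x θ) ∈ B := fun θ hθ =>
    hmem _ ((hxre θ hθ).trans_le (min_le_right _ _))
  have hx0 : x 0 = v w := by simp [hx]
  have hx1 : x 1 = v' w := by simp [hx]
  have hγ0 : ψ (slopePoint (Z' j) (x 0)) = slopePoint (Z i) w := by
    rw [hx0, ← hi, h.left_inv _ hmi]
  have hγ1 : ψ (slopePoint (Z' j) (x 1)) = slopePoint (Z l) w := by
    rw [hx1, ← hl, h.left_inv _ hml]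
  refine hpath i l (fun θ => ψ (slopePoint (Z' j) (x θ))) ?_
    (fun θ hθ => h.mapsTo_right (hxB θ hθ)) ?_ hγ0 hγ1
  · refine h.lipschitz_right.continuousOn.comp ?_ hxB
    have hxc : ContinuousOn x (Set.Icc 0 1) := by fun_prop
    have hZx : ContinuousOn (fun θ => Z' j (x θ)) (Set.Icc 0 1) :=
      (hcont j).comp hxc fun θ hθ => (hxre θ hθ).trans_le (min_le_left _ _)
    have he : ContinuousOn (fun θ => Complex.exp (x θ)) (Set.Icc 0 1) := hxc.cexp
    exact he.prodMk (he.mul hZx)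
  · intro θ hθ
    have h0 : (0 : ℝ) ∈ Set.Icc (0 : ℝ) 1 := by simp
    have h1 := h.lipschitz_right.dist_le_mul _ (hxB θ hθ) _ (hxB 0 h0)
    rw [dist_eq_norm, dist_eq_norm, hx0] at h1
    rw [hx0]
    have h2 := hw j (x θ) (hxδ θ hθ)
    have h3 : ‖Complex.exp (v w)‖ ≤ C * (M * ‖Complex.exp w‖) := by
      refine (norm_exp_le_norm_slopePoint (Z' j) (v w)).trans ?_
      rw [← hi]
      exact (h.norm_le hmi).trans (by gcongr; exact hMi)
    calc _ ≤ C * (1 / (2 * (C * C * M + 1)) * (C * (M * ‖Complex.exp w‖))) :=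
          h1.trans (by gcongr; exact h2.trans (by gcongr))
      _ = C * C * M / (C * C * M + 1) * (‖Complex.exp w‖ / 2) := by field_simp
      _ ≤ 1 * (‖Complex.exp w‖ / 2) := by
          gcongr
          rw [div_le_one (by positivity)]
          linarith
      _ = _ := one_mul _

/-- Lipschitz inverse maps match the sheets injectively. -/
theorem exists_injective [Finite ι] [Finite κ] (hA : IsSheeted A Z t)
    (hB : IsSheeted B Z' t') (h : LipschitzInverses A B φ ψ C) :
    ∃ τ : ι → κ, Function.Injective τ := by
  choose σ hσ using hA.exists_tendsto_slope_map hB h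
  obtain ⟨rep, hrep, hrep'⟩ : ∃ rep : ι → ι, (∀ i, t (rep i) = t i) ∧
      ∀ i l, t i = t l → rep i = rep l :=
    ⟨fun i => Set.rangeSplitting t ⟨t i, i, rfl⟩, fun i => Set.apply_rangeSplitting t _,
      fun i l hil => by simp only [hil]⟩
  set q : ι → ℂ → ℂ × ℂ := fun i w => φ (slopePoint (Z i) w) with hq
  have hT : ∀ i, Tendsto (q i) leftEnd (𝓝[B \ {0}] 0) := hA.tendsto_map_slopePoint h
  have hne : ∀ i, ∀ᶠ w in leftEnd, (q i w).1 ≠ 0 := fun i =>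
    (hT i).eventually hB.eventually_fst_ne_zero
  have hratio : ∀ i, Tendsto (fun w => Complex.log ((q i w).1 / (q (rep i) w).1))
      leftEnd (𝓝 0) := by
    intro i
    obtain ⟨M, hM, hMB⟩ := hB.exists_norm_le
    have hlim := (hA.tendsto_norm_map_sub_div h (hrep i)).const_mul M
    rw [mul_zero] at hlim
    have h0 : Tendsto (fun w => (q i w).1 / (q (rep i) w).1 - 1) leftEnd (𝓝 0) := by
      refine squeeze_zero_norm' ?_ hlim
      filter_upwards [hne (rep i), (hT (rep i)).eventually hMB] with w hw hMw
      have hpos := norm_pos_iff.2 hw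
      have hpos' : 0 < ‖q (rep i) w‖ := hpos.trans_le (norm_fst_le _)
      rw [div_sub_one hw, norm_div, mul_div_assoc', div_le_div_iff₀ hpos hpos']
      have h1 : ‖(q i w).1 - (q (rep i) w).1‖ ≤ ‖q (rep i) w - q i w‖ := by
        rw [norm_sub_rev]; exact norm_fst_le (q (rep i) w - q i w)
      calc _ ≤ ‖q (rep i) w - q i w‖ * (M * ‖(q (rep i) w).1‖) := by gcongr
        _ = _ := by ring
    have h1 : Tendsto (fun w => (q i w).1 / (q (rep i) w).1) leftEnd (𝓝 1) := by
      simpa using h0.add_const 1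
    simpa using h1.clog Complex.one_mem_slitPlane
  set v : ι → ℂ → ℂ := fun i w => Complex.log (q (rep i) w).1 +
    Complex.log ((q i w).1 / (q (rep i) w).1) with hv
  have hexpv : ∀ i, ∀ᶠ w in leftEnd, Complex.exp (v i w) = (q i w).1 := by
    intro i
    filter_upwards [hne i, hne (rep i)] with w h1 h2
    rw [hv, Complex.exp_add, Complex.exp_log h2, Complex.exp_log (div_ne_zero h1 h2)]
    field_simp
  have hvlim : ∀ i, Tendsto (v i) leftEnd leftEnd := by
    intro i
    rw [tendsto_leftEnd_iff]
    have h1 : Tendsto (fun w => (q i w).1) leftEnd (𝓝 0) :=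
      (continuous_fst.tendsto (0 : ℂ × ℂ)).comp (tendsto_nhds_of_tendsto_nhdsWithin (hT i))
    exact h1.congr' ((hexpv i).mono fun w hw => hw.symm)
  have hex : ∀ᶠ w in leftEnd, ∃ τ : ι → κ, ∀ i, q i w = slopePoint (Z' (τ i)) (v i w) := by
    filter_upwards [eventually_all.2 hexpv,
      eventually_all.2 fun i => (hT i).eventually hB.exists_eq] with w h1 h2
    choose τ hτ using fun i => (h2 i).2 _ (h1 i)
    exact ⟨τ, hτ⟩
  obtain ⟨τ, hτ⟩ : ∃ τ : ι → κ, ∃ᶠ w in leftEnd,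
      ∀ i, q i w = slopePoint (Z' (τ i)) (v i w) := by
    by_contra! hcon
    obtain ⟨w, ⟨τ, hw⟩, hw'⟩ := (hex.and (eventually_all.2 hcon)).exists
    exact (hw' τ).elim fun i hi => hi (hw i)
  have hστ : ∀ i, t' (τ i) = σ i := by
    intro i
    refine tendsto_nhds_unique_of_frequently_eq ((hB.tendsto (τ i)).comp (hvlim i)) (hσ i) ?_
    refine hτ.mono fun w hw => ?_
    have := hw i
    simp only [hq] at this
    rw [this, slopePoint_slope]
    rfl
  refine ⟨τ, fun i l hil => ?_⟩
  have htil : t i = t l :=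
    hA.limit_slope_map_injective hB h hσ (by rw [← hστ, ← hστ, hil])
  refine hA.eq_of_frequently_map_eq hB h (j := τ i) (hvlim i) (v' := v l) ?_
    (hτ.mono fun w hw => ⟨hw i, by rw [hil]; exact hw l⟩)
  have h1 := (hratio l).sub (hratio i)
  rw [sub_zero] at h1
  refine h1.congr fun w => ?_
  simp only [hv, hrep' i l htil]
  ring

theorem card_eq [Fintype ι] [Fintype κ] (hA : IsSheeted A Z t)
    (hB : IsSheeted B Z' t') (h : LipschitzInverses A B φ ψ C) :
    Fintype.card ι = Fintype.card κ := by
  obtain ⟨τ, hτ⟩ := hA.exists_injective hB h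
  obtain ⟨τ', hτ'⟩ := hB.exists_injective hA h.symm
  exact le_antisymm (Fintype.card_le_of_injective τ hτ) (Fintype.card_le_of_injective τ' hτ')

end IsSheeted

end Sheeted

section RootSections
open Polynomial

/-- A bivariate polynomial is a smooth function of two variables. -/
theorem Polynomial.contDiff_evalEval (p : ℂ[X][X]) :
    ContDiff ℂ 1 fun q : ℂ × ℂ => p.evalEval q.1 q.2 := by
  have h : (fun q : ℂ × ℂ => p.evalEval q.1 q.2) =
      fun q : ℂ × ℂ => ∑ i ∈ p.support, (p.coeff i).eval q.1 * q.2 ^ i := by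
    ext q
    rw [← map_evalRingHom_eval, eval_map, eval₂_eq_sum, Polynomial.sum]
    rfl
  rw [h]
  refine ContDiff.sum fun i _ => ContDiff.mul ?_ (contDiff_snd.pow i)
  have h1 : ContDiff ℂ 1 fun x : ℂ => (p.coeff i).eval x := by
    simpa using (p.coeff i).contDiff_aeval (𝕜 := ℂ) 1
  exact h1.comp contDiff_fst

theorem Polynomial.continuous_evalEval (p : ℂ[X][X]) :
    Continuous fun q : ℂ × ℂ => p.evalEval q.1 q.2 := p.contDiff_evalEval.continuous

theorem Polynomial.hasDerivAt_evalEval (p : ℂ[X][X]) (x y : ℂ) :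
    HasDerivAt (fun y => p.evalEval x y) ((derivative p).evalEval x y) y := by
  have := (p.map (evalRingHom x)).hasDerivAt y
  rw [derivative_map, map_evalRingHom_eval] at this
  simpa only [map_evalRingHom_eval] using this

theorem Polynomial.exists_openPartialHomeomorph_evalEval (p : ℂ[X][X]) {q : ℂ × ℂ}
    (hq : (derivative p).evalEval q.1 q.2 ≠ 0) :
    ∃ e : OpenPartialHomeomorph (ℂ × ℂ) (ℂ × ℂ), q ∈ e.source ∧
      (fun q : ℂ × ℂ => (q.1, p.evalEval q.1 q.2)) = e := by
  have hs := p.contDiff_evalEval.contDiffAt (x := q) |>.hasStrictFDerivAt one_ne_zero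
  set L := fderiv ℂ (fun q : ℂ × ℂ => p.evalEval q.1 q.2) q with hL
  have hL1 : L (0, 1) = (derivative p).evalEval q.1 q.2 := by
    have h1 : HasDerivAt (fun y : ℂ => (q.1, y)) ((0 : ℂ), (1 : ℂ)) q.2 :=
      (hasDerivAt_const _ _).prodMk (hasDerivAt_id _)
    have h2 := (hs.hasFDerivAt (x := (q.1, q.2))).comp_hasDerivAt q.2 h1
    exact h2.unique (p.hasDerivAt_evalEval q.1 q.2)
  have hinj : Function.Injective ((ContinuousLinearMap.fst ℂ ℂ ℂ).prod L) := by
    rw [injective_iff_map_eq_zero]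
    rintro ⟨a, b⟩ hab
    simp only [ContinuousLinearMap.prod_apply, ContinuousLinearMap.coe_fst', Prod.mk_eq_zero] at hab
    obtain ⟨rfl, hb⟩ := hab
    have : ((0 : ℂ), b) = b • ((0 : ℂ), (1 : ℂ)) := by simp
    rw [this, map_smul, hL1, smul_eq_mul, mul_eq_zero, or_iff_left hq] at hb
    simp [hb]
  let e : (ℂ × ℂ) ≃L[ℂ] (ℂ × ℂ) := (LinearEquiv.ofInjectiveEndo
    (((ContinuousLinearMap.fst ℂ ℂ ℂ).prod L : (ℂ × ℂ) →L[ℂ] (ℂ × ℂ)) : (ℂ × ℂ) →ₗ[ℂ] (ℂ × ℂ))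
    hinj).toContinuousLinearEquiv
  have he : HasStrictFDerivAt (fun q : ℂ × ℂ => (q.1, p.evalEval q.1 q.2))
      (e : (ℂ × ℂ) →L[ℂ] (ℂ × ℂ)) q := by
    have h1 : (e : (ℂ × ℂ) →L[ℂ] (ℂ × ℂ)) = (ContinuousLinearMap.fst ℂ ℂ ℂ).prod L := by
      ext <;> rfl
    rw [h1]
    exact hasStrictFDerivAt_fst.prodMk hs
  exact ⟨he.toOpenPartialHomeomorph _, he.mem_toOpenPartialHomeomorph_source, by simp⟩

theorem Polynomial.norm_lt_of_evalEval_eq {p : ℂ[X][X]} (hp : p.Monic) (hdeg : 0 < p.natDegree)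
    {x y c : ℂ} {M : ℝ≥0} (hM : ∀ i < p.natDegree, ‖(p.coeff i).eval x‖₊ ≤ M)
    (h : p.evalEval x y = c) : ‖y‖ < M + ‖c‖ + 1 := by
  set P := p.map (evalRingHom x) - C c with hP
  have hPd : P.natDegree = p.natDegree := by
    rw [hP, natDegree_sub_C, hp.natDegree_map]
  have hroot : P.IsRoot y := by
    simp [hP, IsRoot.def, map_evalRingHom_eval, h]
  have hPm : P.Monic := by
    refine (hp.map (evalRingHom x)).sub_of_left ?_
    rw [hp.degree_map, degree_eq_natDegree hp.ne_zero]
    exact degree_C_le.trans_lt (by exact_mod_cast hdeg)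
  have h1 := hroot.norm_lt_cauchyBound hPm.ne_zero
  have h2 : cauchyBound P ≤ M + ‖c‖₊ + 1 := by
    rw [cauchyBound, hPm.leadingCoeff, nnnorm_one, div_one]
    gcongr
    refine Finset.sup_le fun i hi => ?_
    rw [Finset.mem_range, hPd] at hi
    rw [hP, coeff_sub, coeff_map, coe_evalRingHom]
    refine (nnnorm_sub_le _ _).trans (add_le_add (hM i hi) ?_)
    rw [coeff_C]
    split_ifs <;> simp
  exact_mod_cast h1.trans_le h2

theorem Polynomial.isClosedMap_evalEval {p : ℂ[X][X]} (hp : p.Monic) (hdeg : 0 < p.natDegree) :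
    IsClosedMap fun q : ℂ × ℂ => (q.1, p.evalEval q.1 q.2) := by
  have hc : Continuous fun q : ℂ × ℂ => (q.1, p.evalEval q.1 q.2) :=
    continuous_fst.prodMk p.continuous_evalEval
  refine (isProperMap_iff_isCompact_preimage.2 ⟨hc, fun K hK => ?_⟩).isClosedMap
  obtain ⟨R, hR⟩ := hK.isBounded.exists_norm_le
  have hcoeff : Continuous fun x : ℂ => ∑ i ∈ Finset.range p.natDegree, ‖(p.coeff i).eval x‖₊ := by
    fun_prop
  obtain ⟨M, hM⟩ := ((isCompact_closedBall (0 : ℂ) R).bddAbove_image hcoeff.continuousOn)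
  refine Metric.isCompact_of_isClosed_isBounded (hK.isClosed.preimage hc) ?_
  refine isBounded_iff_forall_norm_le.2 ⟨max R (M + R + 1), fun q hq => ?_⟩
  have hq1 := hR _ hq
  have hq2 : ‖q.1‖ ≤ R := (norm_fst_le (q.1, p.evalEval q.1 q.2)).trans hq1
  have hq3 : ‖p.evalEval q.1 q.2‖ ≤ R := (norm_snd_le (q.1, p.evalEval q.1 q.2)).trans hq1
  have hMq := hM (Set.mem_image_of_mem _ (mem_closedBall_zero_iff.2 hq2))
  have h2 := norm_lt_of_evalEval_eq hp hdeg (x := q.1) (y := q.2) (M := M)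
    (fun i hi => (Finset.single_le_sum (f := fun i => ‖(p.coeff i).eval q.1‖₊)
      (fun _ _ => zero_le) (Finset.mem_range.2 hi)).trans hMq) rfl
  rw [Prod.norm_def]
  exact max_le_max hq2 (by linarith)

/-- Over a half-plane on which all roots are simple, the roots of a monic polynomial whose
coefficients are polynomials in `exp w` are enumerated by continuous functions of `w`. -/
theorem Polynomial.exists_root_sections {p : ℂ[X][X]} (hp : p.Monic) (hdeg : 0 < p.natDegree)
    {ρ : ℝ} (hsep : ∀ w : ℂ, w.re < ρ → (p.map (evalRingHom (Complex.exp w))).Separable) :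
    ∃ (n : ℕ) (Y : Fin n → ℂ → ℂ), (∀ i, ContinuousOn (Y i) {w | w.re < ρ}) ∧
      ∀ w : ℂ, w.re < ρ → Function.Injective (fun i => Y i w) ∧
        ∀ y, p.evalEval (Complex.exp w) y = 0 ↔ ∃ i, y = Y i w := by
  set G : ℂ × ℂ → ℂ × ℂ := fun q => (q.1, p.evalEval q.1 q.2) with hG
  set S : Set (ℂ × ℂ) := {q | ∀ y, p.evalEval q.1 y = q.2 → (derivative p).evalEval q.1 y ≠ 0}
    with hS
  have hfin : ∀ x c, {y | p.evalEval x y = c}.Finite := by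
    intro x c
    have hne : p.map (evalRingHom x) - C c ≠ 0 := by
      intro h0
      have := congrArg natDegree h0
      rw [natDegree_sub_C, hp.natDegree_map, natDegree_zero] at this
      lia
    refine (rootSet_finite (p.map (evalRingHom x) - C c) ℂ).subset fun y hy => ?_
    rw [mem_rootSet]
    refine ⟨hne, ?_⟩
    simpa [map_evalRingHom_eval, sub_eq_zero] using hy
  have hcov : IsCoveringMapOn G S := by
    refine (isClosedMap_evalEval hp hdeg).isCoveringMapOn_of_isLocalHomeomorphOn ?_ ?_
    · rintro ⟨x, c⟩ -
      refine ((hfin x c).image (Prod.mk x)).subset ?_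
      rintro ⟨x', y⟩ h
      simp only [Set.mem_preimage, Set.mem_singleton_iff, Prod.mk.injEq] at h
      exact ⟨y, by rw [← h.1]; exact h.2, by rw [h.1]⟩
    · intro q hq
      exact p.exists_openPartialHomeomorph_evalEval (hq q.2 rfl)
  set H : Set ℂ := {w | w.re < ρ} with hH
  have hHo : IsOpen H := isOpen_lt Complex.continuous_re continuous_const
  have hHc : Convex ℝ H := convex_halfSpace_re_lt ρ
  set w₀ : H := ⟨((ρ - 1 : ℝ) : ℂ), by simp [hH]⟩
  have : ContractibleSpace H := hHc.contractibleSpace ⟨w₀, w₀.2⟩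
  have : LocallyPathConnectedSpace H := hHo.locallyPathConnectedSpace
  let F : C(H, ℂ × ℂ) := ⟨fun w => (Complex.exp w, 0), by fun_prop⟩
  have hFS : ∀ w, F w ∈ S := by
    intro w y hy
    have h1 := (hsep w w.2).eval₂_derivative_ne_zero (RingHom.id ℂ) (x := y)
    rw [eval₂_id, eval₂_id, derivative_map, map_evalRingHom_eval, map_evalRingHom_eval] at h1
    exact h1 hy
  have hlift : ∀ (w : H) (y : ℂ), p.evalEval (Complex.exp w) y = 0 →
      ∃! L : C(H, ℂ × ℂ), L w = (Complex.exp w, y) ∧ G ∘ L = F := fun w y hy =>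
    hcov.existsUnique_continuousMap_lifts F (a₀ := w) (e₀ := (Complex.exp w, y))
      (by simp [hG, F, hy]) hFS
  have hval : ∀ L : C(H, ℂ × ℂ), G ∘ L = F → ∀ w : H,
      L w = (Complex.exp w, (L w).2) ∧ p.evalEval (Complex.exp w) (L w).2 = 0 := by
    intro L hL w
    have h1 := congrFun hL w
    simp only [hG, F, Function.comp_apply, ContinuousMap.coe_mk, Prod.mk.injEq] at h1
    exact ⟨Prod.ext h1.1 rfl, by rw [← h1.1]; exact h1.2⟩
  have huniq : ∀ L L' : C(H, ℂ × ℂ), G ∘ L = F → G ∘ L' = F → ∀ w : H,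
      (L w).2 = (L' w).2 → L = L' := by
    intro L L' hL hL' w hw
    refine (hlift w (L w).2 (hval L hL w).2).unique ⟨(hval L hL w).1, hL⟩ ⟨?_, hL'⟩
    rw [hw]
    exact (hval L' hL' w).1
  obtain ⟨n, r, hrinj, hr⟩ : ∃ (n : ℕ) (r : Fin n → ℂ), Function.Injective r ∧
      ∀ y, p.evalEval (Complex.exp w₀) y = 0 ↔ ∃ i, r i = y := by
    have := (hfin (Complex.exp w₀) 0).to_subtype
    obtain ⟨n, ⟨e⟩⟩ := Finite.exists_equiv_fin {y | p.evalEval (Complex.exp w₀) y = 0}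
    refine ⟨n, fun i => (e.symm i).1, Subtype.val_injective.comp e.symm.injective, fun y => ?_⟩
    exact ⟨fun hy => ⟨e ⟨y, hy⟩, by simp⟩, by rintro ⟨i, rfl⟩; exact (e.symm i).2⟩
  choose L hL using fun i => (hlift w₀ (r i) ((hr _).2 ⟨i, rfl⟩)).exists
  classical
  refine ⟨n, fun i w => if h : w ∈ H then (L i ⟨w, h⟩).2 else 0, fun i => ?_, fun w hw => ?_⟩
  · rw [continuousOn_iff_continuous_domRestrict]
    refine (continuous_snd.comp (L i).continuous).congr fun w => ?_
    simp
  · have hwH : w ∈ H := hw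
    simp only [hwH, dite_true]
    refine ⟨fun i j hij => ?_, fun y => ⟨fun hy => ?_, ?_⟩⟩
    · have h1 := huniq _ _ (hL i).2 (hL j).2 ⟨w, hwH⟩ hij
      apply hrinj
      have h2 := (hL i).1
      rw [h1, (hL j).1] at h2
      exact (congrArg Prod.snd h2).symm
    · obtain ⟨L', hL'⟩ := (hlift ⟨w, hwH⟩ y hy).exists
      obtain ⟨i, hi⟩ := (hr _).1 (hval L' hL'.2 w₀).2
      refine ⟨i, ?_⟩
      rw [huniq (L i) L' (hL i).2 hL'.2 w₀ (by rw [(hL i).1]; exact hi), hL'.1]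
    · rintro ⟨i, rfl⟩
      exact (hval (L i) (hL i).2 ⟨w, hwH⟩).2

theorem Polynomial.eq_prod_X_sub_C_of_separable {P : ℂ[X]} (hP : P.Monic) (hsep : P.Separable)
    {n : ℕ} {r : Fin n → ℂ} (hr : Function.Injective r) (h : ∀ y, P.eval y = 0 ↔ ∃ i, y = r i) :
    P = ∏ i, (X - C (r i)) := by
  have hroots : P.roots = Finset.univ.val.map r := by
    refine (Multiset.Nodup.ext (nodup_roots hsep) (Finset.univ.nodup.map hr)).2 fun y => ?_
    rw [mem_roots hP.ne_zero, IsRoot.def, h]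
    simp [eq_comm]
  conv_lhs => rw [(IsAlgClosed.splits P).eq_prod_roots_of_monic hP, hroots]
  rw [Multiset.map_map]
  rfl

end RootSections

section Separable
open Polynomial

theorem Polynomial.Monic.squarefree_map_fractionRing {R : Type*} [CommRing R] [IsDomain R]
    [IsIntegrallyClosed R] {p : R[X]} (hp : p.Monic) (hsq : Squarefree p) :
    Squarefree (p.map (algebraMap R (FractionRing R))) := by
  intro q hq
  obtain ⟨g, hg⟩ := IsIntegrallyClosed.eq_map_mul_C_of_dvd (FractionRing R) hp
    ((dvd_mul_right q q).trans hq)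
  have hq0 : q ≠ 0 := by
    rintro rfl
    exact (hp.map (algebraMap R (FractionRing R))).ne_zero (zero_dvd_iff.1 (by simpa using hq))
  have hlc : q.leadingCoeff ≠ 0 := leadingCoeff_ne_zero.2 hq0
  have hu : IsUnit (C q.leadingCoeff) := isUnit_C.2 hlc.isUnit
  have hgm : g.Monic := by
    have h1 := congrArg Polynomial.leadingCoeff hg
    rw [leadingCoeff_mul, leadingCoeff_C, mul_eq_right₀ hlc] at h1
    exact monic_of_injective (IsFractionRing.injective R (FractionRing R)) h1
  have hgg : g * g ∣ p := by
    rw [← Monic.dvd_iff_fraction_map_dvd_fraction_map (K := FractionRing R) hp (hgm.mul hgm),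
      Polynomial.map_mul]
    refine dvd_trans ?_ hq
    rw [← hg]
    exact mul_dvd_mul (dvd_mul_right _ _) (dvd_mul_right _ _)
  rw [← hg]
  exact ((hsq g hgg).map (mapRingHom (algebraMap R (FractionRing R)))).mul hu

/-- A squarefree monic polynomial satisfies a Bézout identity with its derivative. -/
theorem Polynomial.Monic.exists_mul_add_mul_derivative {R : Type*} [CommRing R] [IsDomain R]
    [IsIntegrallyClosed R] [CharZero R] {p : R[X]} (hp : p.Monic) (hsq : Squarefree p) :
    ∃ (A B : R[X]) (d : R), d ≠ 0 ∧ A * p + B * derivative p = C d := by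
  have : CharZero (FractionRing R) :=
    charZero_of_injective_algebraMap (IsFractionRing.injective R (FractionRing R))
  obtain ⟨u, v, huv⟩ := PerfectField.separable_iff_squarefree.2 (hp.squarefree_map_fractionRing hsq)
  obtain ⟨b, hb, hbu⟩ := IsLocalization.integerNormalization_spec (nonZeroDivisors R) u
  obtain ⟨c, hc, hcv⟩ := IsLocalization.integerNormalization_spec (nonZeroDivisors R) v
  refine ⟨C c * IsLocalization.integerNormalization (nonZeroDivisors R) u,
    C b * IsLocalization.integerNormalization (nonZeroDivisors R) v, b * c,
    mul_ne_zero (nonZeroDivisors.ne_zero hb) (nonZeroDivisors.ne_zero hc), ?_⟩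
  apply Polynomial.map_injective _ (IsFractionRing.injective R (FractionRing R))
  simp only [Polynomial.map_add, Polynomial.map_mul, hbu, hcv, map_C, ← derivative_map, map_mul]
  simp only [← algebraMap_smul (FractionRing R) b, ← algebraMap_smul (FractionRing R) c,
    smul_eq_C_mul]
  linear_combination
    (C (algebraMap R (FractionRing R) b) * C (algebraMap R (FractionRing R) c)) * huv

theorem Polynomial.Monic.exists_separable {p : ℂ[X][X]} (hp : p.Monic) (hsq : Squarefree p) :
    ∃ ρ : ℝ, ∀ w : ℂ, w.re < ρ → (p.map (evalRingHom (Complex.exp w))).Separable := by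
  obtain ⟨A, B, d, hd, h⟩ := hp.exists_mul_add_mul_derivative hsq
  have hev : ∀ᶠ x in 𝓝[≠] (0 : ℂ), d.eval x ≠ 0 := by
    have hfin : (d.rootSet ℂ \ {0}).Finite := (rootSet_finite d ℂ).subset Set.sdiff_subset
    filter_upwards [nhdsWithin_le_nhds (hfin.isClosed.compl_mem_nhds (by simp)),
      self_mem_nhdsWithin] with x hx hx0 hdx
    exact hx ⟨Polynomial.mem_rootSet.2 ⟨hd, by simpa using hdx⟩, hx0⟩
  obtain ⟨ρ, hρ⟩ := eventually_leftEnd.1 (tendsto_exp_leftEnd.eventually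
    (eventually_nhdsWithin_iff.1 hev))
  refine ⟨ρ, fun w hw => ?_⟩
  have hne : d.eval (Complex.exp w) ≠ 0 := hρ w hw (Complex.exp_ne_zero w)
  have h1 := congrArg (Polynomial.map (evalRingHom (Complex.exp w))) h
  rw [Polynomial.map_add, Polynomial.map_mul, Polynomial.map_mul, map_C, coe_evalRingHom,
    ← derivative_map] at h1
  refine ⟨C (d.eval (Complex.exp w))⁻¹ * A.map (evalRingHom (Complex.exp w)),
    C (d.eval (Complex.exp w))⁻¹ * B.map (evalRingHom (Complex.exp w)), ?_⟩
  rw [mul_assoc, mul_assoc, ← mul_add, h1, ← C_mul, inv_mul_cancel₀ hne, C_1]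

end Separable

section Sheets
open Polynomial

/-- A bounded continuous branch of solutions of `Q (exp w, z) = 0` has a limit as `exp w → 0`. -/
theorem exists_tendsto_of_root_section {Q : ℂ × ℂ → ℂ} (hQ : Continuous Q)
    (hfin : {z | Q (0, z) = 0}.Finite) {g : ℂ → ℂ} {ρ M : ℝ}
    (hg : ContinuousOn g {w | w.re < ρ}) (hM : ∀ᶠ w in leftEnd, ‖g w‖ ≤ M)
    (h0 : ∀ᶠ w in leftEnd, Q (Complex.exp w, g w) = 0) :
    ∃ t, Q (0, t) = 0 ∧ Tendsto g leftEnd (𝓝 t) := by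
  refine exists_tendsto_leftEnd hfin hg fun ε hε => ?_
  set K : Set ℂ := Metric.closedBall 0 M ∩ ⋂ t ∈ {z | Q (0, z) = 0}, {z | ε ≤ ‖z - t‖} with hK
  have hKc : IsCompact K := (isCompact_closedBall 0 M).inter_right
    (isClosed_biInter fun t _ => isClosed_le continuous_const (by fun_prop))
  have hne : ∀ᶠ x in 𝓝 (0 : ℂ), ∀ z ∈ K, Q (x, z) ≠ 0 := by
    refine hKc.eventually_forall_of_forall_eventually fun z hz => ?_
    refine hQ.continuousAt.eventually_ne fun hz0 => ?_
    have h1 := Set.mem_iInter₂.1 hz.2 z hz0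
    simp only [sub_self, norm_zero, Set.mem_ofPred_eq] at h1
    linarith
  filter_upwards [hM, h0, tendsto_exp_leftEnd.eventually hne] with w hMw hw hKw
  by_contra! hcon
  exact hKw (g w) ⟨mem_closedBall_zero_iff.2 hMw, Set.mem_iInter₂.2 hcon⟩ hw

theorem eventually_of_exp_eq {P : ℂ → Prop} (h : ∀ᶠ w in leftEnd, P w) :
    ∀ᶠ x in 𝓝 (0 : ℂ), ∀ w, Complex.exp w = x → P w := by
  obtain ⟨ρ, hρ⟩ := eventually_leftEnd.1 h
  filter_upwards [Metric.ball_mem_nhds (0 : ℂ) (Real.exp_pos ρ)] with x hx w hw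
  rw [mem_ball_zero_iff, ← hw, Complex.norm_exp, Real.exp_lt_exp] at hx
  exact hρ w hx

theorem eq_of_pow_mul_eq_pow_mul {m k : ℕ} {F G : ℂ → ℂ} (hF : Continuous F) (hG : Continuous G)
    (hF0 : F 0 ≠ 0) (hG0 : G 0 ≠ 0) (h : ∀ y, y ^ m * F y = y ^ k * G y) : m = k := by
  wlog hmk : m ≤ k generalizing m k F G
  · exact (this hG hF hG0 hF0 (fun y => (h y).symm) (le_of_not_ge hmk)).symm
  by_contra hne
  obtain ⟨j, rfl⟩ := Nat.exists_eq_add_of_le hmk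
  have hj : j ≠ 0 := by lia
  have h1 : ∀ y ≠ 0, F y = y ^ j * G y := fun y hy =>
    mul_left_cancel₀ (pow_ne_zero m hy) (by rw [h y]; ring)
  have h2 : Tendsto F (𝓝[≠] 0) (𝓝 (F 0)) := hF.continuousAt.tendsto.mono_left nhdsWithin_le_nhds
  have h3 : Tendsto (fun y => y ^ j * G y) (𝓝[≠] 0) (𝓝 (0 ^ j * G 0)) :=
    ((continuous_pow j).mul hG).continuousAt.tendsto.mono_left nhdsWithin_le_nhds
  rw [zero_pow hj, zero_mul] at h3
  exact hF0 (tendsto_nhds_unique h2 (h3.congr' (eventually_nhdsWithin_of_forall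
    fun y hy => (h1 y hy).symm)))

theorem Polynomial.exists_mul_norm_le {p : ℂ[X][X]} {m : ℕ} {Q : ℂ × ℂ → ℂ} (hQ : Continuous Q)
    (h : ∀ u y, p.evalEval (u * y) y = y ^ m * Q (u, y)) (h0 : Q 0 ≠ 0) :
    ∃ r > 0, ∀ x y, p.evalEval x y = 0 → ‖y‖ < r → r * ‖y‖ ≤ ‖x‖ := by
  obtain ⟨r, hr, hrQ⟩ := Metric.eventually_nhds_iff.1 (hQ.continuousAt.eventually_ne h0)
  refine ⟨r, hr, fun x y hxy hy => ?_⟩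
  by_contra! hlt
  rcases eq_or_ne y 0 with rfl | hy0
  · simp at hlt
    linarith [norm_nonneg x]
  have h1 := h (x / y) y
  rw [div_mul_cancel₀ _ hy0, hxy, eq_comm, mul_eq_zero, or_iff_right (pow_ne_zero m hy0)] at h1
  refine hrQ (y := (x / y, y)) ?_ h1
  rw [dist_zero_right, Prod.norm_def, max_lt_iff, norm_div, div_lt_iff₀ (norm_pos_iff.2 hy0)]
  exact ⟨hlt, hy⟩

/-- A plane curve without vertical tangent at the origin has `m` sheets there, where `m` is its
multiplicity. -/
theorem Polynomial.exists_isSheeted {p : ℂ[X][X]} (hp : p.Monic) (hsq : Squarefree p)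
    (hdeg : 0 < p.natDegree) {m : ℕ} {Q₁ Q₂ : ℂ × ℂ → ℂ} (hc₁ : Continuous Q₁)
    (hc₂ : Continuous Q₂) (h₁ : ∀ u y, p.evalEval (u * y) y = y ^ m * Q₁ (u, y))
    (h₁0 : Q₁ 0 ≠ 0) (h₂ : ∀ x z, p.evalEval x (x * z) = x ^ m * Q₂ (x, z))
    (hfin : {z | Q₂ (0, z) = 0}.Finite) :
    ∃ (Z : Fin m → ℂ → ℂ) (t : Fin m → ℂ), IsSheeted {q | p.evalEval q.1 q.2 = 0} Z t := by
  obtain ⟨ρ, hρ⟩ := hp.exists_separable hsq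
  obtain ⟨n, Y, hYc, hY⟩ := exists_root_sections hp hdeg hρ
  obtain ⟨r, hr, hcone⟩ := exists_mul_norm_le hc₁ h₁ h₁0
  have hleft : ∀ᶠ w in leftEnd, w.re < ρ := eventually_leftEnd.2 ⟨ρ, fun w hw => hw⟩
  have hroot : ∀ i, ∀ᶠ w in leftEnd, p.evalEval (Complex.exp w) (Y i w) = 0 := fun i =>
    hleft.mono fun w hw => ((hY w hw).2 _).2 ⟨i, rfl⟩
  obtain ⟨M, hM⟩ : ∃ M : ℝ, ∀ i, ∀ᶠ w in leftEnd, ‖Y i w‖ ≤ M := by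
    have hcoeff : Continuous fun x : ℂ =>
      ∑ i ∈ Finset.range p.natDegree, ‖(p.coeff i).eval x‖₊ := by fun_prop
    set N := ∑ i ∈ Finset.range p.natDegree, ‖(p.coeff i).eval 0‖₊
    refine ⟨(N + 1 : ℝ≥0) + ‖(0 : ℂ)‖ + 1, fun i => ?_⟩
    filter_upwards [hroot i, tendsto_exp_leftEnd.eventually (hcoeff.continuousAt.eventually_lt
      (continuousAt_const (y := N + 1)) (lt_add_one N))] with w hw hN
    refine (norm_lt_of_evalEval_eq hp hdeg (fun i hi => ?_) hw).le
    exact (Finset.single_le_sum (f := fun i => ‖(p.coeff i).eval (Complex.exp w)‖₊)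
      (fun _ _ => zero_le) (Finset.mem_range.2 hi)).trans hN.le
  have hfin0 : {y | p.evalEval 0 y = 0}.Finite := by
    refine (rootSet_finite (p.map (evalRingHom 0)) ℂ).subset fun y hy => ?_
    rw [(hp.map (evalRingHom 0)).mem_rootSet]
    simpa [map_evalRingHom_eval] using hy
  choose η hη using fun i => exists_tendsto_of_root_section p.continuous_evalEval hfin0 (hYc i)
    (hM i) (hroot i)
  have hprod : ∀ y, p.evalEval 0 y = ∏ i, (y - η i) := by
    intro y
    have hl : Tendsto (fun w => p.evalEval (Complex.exp w) y) leftEnd (𝓝 (p.evalEval 0 y)) := by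
      have hc : Continuous fun x => p.evalEval x y :=
        p.continuous_evalEval.comp (continuous_id.prodMk continuous_const)
      exact (hc.tendsto 0).comp tendsto_exp_leftEnd
    refine tendsto_nhds_unique (hl.congr' ?_)
      (tendsto_finsetProd Finset.univ fun i _ => tendsto_const_nhds.sub (hη i).2)
    filter_upwards [hleft] with w hw
    rw [← map_evalRingHom_eval, eq_prod_X_sub_C_of_separable (hp.map _) (hρ w hw) (hY w hw).1
      (fun y => by rw [map_evalRingHom_eval]; exact (hY w hw).2 y), eval_prod]
    simp
  have hcard : Fintype.card {i // η i = 0} = m := by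
    rw [Fintype.card_subtype]
    refine eq_of_pow_mul_eq_pow_mul (F := fun y => ∏ i with η i ≠ 0, (y - η i))
      (G := fun y => Q₁ (0, y)) (by fun_prop) (by fun_prop) ?_ h₁0 fun y => ?_
    · rw [Finset.prod_ne_zero_iff]
      intro i hi
      simpa using hi
    · rw [← h₁, zero_mul, hprod, ← Finset.prod_filter_mul_prod_filter_not Finset.univ (η · = 0)]
      congr 1
      rw [← Finset.prod_const]
      refine Finset.prod_congr rfl fun i hi => ?_
      rw [(Finset.mem_filter.1 hi).2, sub_zero]
  have e : Fin m ≃ {i // η i = 0} := (Fintype.equivFinOfCardEq hcard).symm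
  set Z : Fin m → ℂ → ℂ := fun j w => Y (e j) w * Complex.exp (-w) with hZ
  have hexp : ∀ w y, Complex.exp w * (y * Complex.exp (-w)) = y := fun w y => by
    rw [Complex.exp_neg, mul_left_comm, mul_inv_cancel₀ (Complex.exp_ne_zero w), mul_one]
  have hpoint : ∀ j w, slopePoint (Z j) w = (Complex.exp w, Y (e j) w) := fun j w => by
    rw [slopePoint, hZ, hexp]
  have hZc : ∀ j, ContinuousOn (Z j) {w | w.re < ρ} := fun j =>
    (hYc _).mul (by fun_prop)
  have hZM : ∀ j, ∀ᶠ w in leftEnd, ‖Z j w‖ ≤ r⁻¹ := by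
    intro j
    have hlim := (hη (e j)).2
    rw [(e j).2] at hlim
    filter_upwards [hroot (e j), hlim.eventually (Metric.ball_mem_nhds 0 hr)] with w hw hw'
    have h3 := hcone _ _ hw (mem_ball_zero_iff.1 hw')
    rw [hZ, norm_mul, Complex.exp_neg, norm_inv, ← div_eq_mul_inv,
      div_le_iff₀ (norm_pos_iff.2 (Complex.exp_ne_zero w)), inv_mul_eq_div, le_div_iff₀ hr]
    linarith
  have hZroot : ∀ j, ∀ᶠ w in leftEnd, Q₂ (Complex.exp w, Z j w) = 0 := by
    intro j
    filter_upwards [hroot (e j)] with w hw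
    have h3 := h₂ (Complex.exp w) (Z j w)
    rwa [hexp, hw, eq_comm, mul_eq_zero,
      or_iff_right (pow_ne_zero m (Complex.exp_ne_zero w))] at h3
  choose t ht using fun j => exists_tendsto_of_root_section hc₂ hfin (hZc j) (hZM j) (hZroot j)
  refine ⟨Z, t, ⟨ρ, hZc⟩, ?_, fun j => (ht j).2, fun j => ?_, ?_⟩
  · filter_upwards [hleft] with w hw j j' hjj'
    exact e.injective (Subtype.val_injective
      ((hY w hw).1 (mul_right_cancel₀ (Complex.exp_ne_zero _) hjj')))
  · filter_upwards [hroot (e j)] with w hw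
    rw [hpoint]
    exact hw
  · have hfar : ∀ᶠ q in 𝓝 (0 : ℂ × ℂ), ∀ i, η i ≠ 0 → ∀ w, Complex.exp w = q.1 →
        Y i w ≠ q.2 := by
      refine eventually_all.2 fun i => ?_
      by_cases hi : η i = 0
      · exact Eventually.of_forall fun _ h => absurd hi h
      have hpos := norm_pos_iff.2 hi
      have h3 : ∀ᶠ w in leftEnd, ‖η i‖ / 2 < ‖Y i w‖ :=
        ((hη i).2.norm).eventually (lt_mem_nhds (half_lt_self hpos))
      filter_upwards [(continuous_fst.tendsto (0 : ℂ × ℂ)).eventually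
        (eventually_of_exp_eq h3), Metric.ball_mem_nhds (0 : ℂ × ℂ) (half_pos hpos)]
        with q hq hq' _ w hw heq
      have h4 := hq w hw
      rw [heq] at h4
      exact absurd ((norm_snd_le q).trans_lt (mem_ball_zero_iff.1 hq')) (not_lt.2 h4.le)
    filter_upwards [self_mem_nhdsWithin, nhdsWithin_le_nhds hfar,
      nhdsWithin_le_nhds (Metric.ball_mem_nhds (0 : ℂ × ℂ) hr),
      nhdsWithin_le_nhds ((continuous_fst.tendsto (0 : ℂ × ℂ)).eventually
        (eventually_of_exp_eq hleft))] with q hq hqfar hqr hqleft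
    have h3 := hcone q.1 q.2 hq.1 ((norm_snd_le q).trans_lt (mem_ball_zero_iff.1 hqr))
    refine ⟨fun hq1 => hq.2 ?_, fun w hw => ?_⟩
    · rw [hq1, norm_zero] at h3
      have h4 : ‖q.2‖ ≤ 0 := by nlinarith [norm_nonneg q.2]
      exact Prod.ext hq1 (norm_le_zero_iff.1 h4)
    · obtain ⟨i, hi⟩ := ((hY w (hqleft w hw)).2 q.2).1 (by rw [hw]; exact hq.1)
      have hi0 : η i = 0 := by
        by_contra hne
        exact hqfar i hne w hw hi.symm
      refine ⟨e.symm ⟨i, hi0⟩, ?_⟩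
      rw [hpoint, Equiv.apply_symm_apply, hw, ← hi]

end Sheets

theorem IsSheeted.inter {ι : Type*} {A U : Set (ℂ × ℂ)} {Z : ι → ℂ → ℂ} {t : ι → ℂ}
    (h : IsSheeted A Z t) (hU : U ∈ 𝓝 0) : IsSheeted (A ∩ U) Z t where
  continuousOn := h.continuousOn
  injective := h.injective
  tendsto := h.tendsto
  mem i := by
    have hlim : Tendsto (slopePoint (Z i)) leftEnd (𝓝 0) := by
      have h1 := tendsto_exp_leftEnd.prodMk_nhds (tendsto_exp_leftEnd.mul (h.tendsto i))
      rwa [zero_mul] at h1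
    exact (h.mem i).and (hlim.eventually hU)
  exists_eq := h.exists_eq.filter_mono
    (nhdsWithin_mono _ (Set.sdiff_subset_sdiff_left Set.inter_subset_left))

theorem MvPolynomial.IsHomogeneous.eval_smul_eq {σ R : Type*} [Fintype σ] [CommSemiring R]
    {F : MvPolynomial σ R} {n : ℕ} (hF : F.IsHomogeneous n) (c : R) (v : σ → R) :
    eval (c • v) F = c ^ n * eval v F := by
  rw [eval_eq', eval_eq', Finset.mul_sum]
  refine Finset.sum_congr rfl fun d hd => ?_
  have h1 : ∏ i, c ^ d i = c ^ n := by
    rw [Finset.prod_pow_eq_pow_sum, ← Finsupp.degree_eq_sum]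
    by_contra hne
    exact mem_support_iff.1 hd (hF.coeff_eq_zero fun h => hne (by rw [h]))
  simp only [Pi.smul_apply, smul_eq_mul, mul_pow, Finset.prod_mul_distrib, h1]
  ring

/-- The expansion of a polynomial around the origin, starting from its initial form. -/
theorem MvPolynomial.exists_eval_smul_eq {f : MvPolynomial (Fin 2) ℂ} {m : ℕ}
    (hm : ∀ d < m, homogeneousComponent d f = 0) :
    ∃ Q : ℂ × (Fin 2 → ℂ) → ℂ, Continuous Q ∧
      (∀ v, Q (0, v) = eval v (homogeneousComponent m f)) ∧
      ∀ s v, eval (s • v) f = s ^ m * Q (s, v) := by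
  refine ⟨fun q => ∑ i ∈ Finset.range (f.totalDegree + 1),
    q.1 ^ i * eval q.2 (homogeneousComponent (m + i) f), ?_, fun v => ?_, fun s v => ?_⟩
  · refine continuous_finsetSum _ fun i _ => (continuous_fst.pow i).mul ?_
    exact (MvPolynomial.continuous_eval _).comp continuous_snd
  · refine (Finset.sum_eq_single_of_mem 0 (by simp) ?_).trans ?_
    · intro i _ hi
      simp [zero_pow hi]
    · simp
  · have h1 : f = ∑ i ∈ Finset.range (m + (f.totalDegree + 1)), homogeneousComponent i f := by
      conv_lhs => rw [← sum_homogeneousComponent f]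
      refine Finset.sum_subset (by simp) fun i _ hi => homogeneousComponent_eq_zero i f ?_
      simpa using hi
    conv_lhs => rw [h1]
    rw [Finset.sum_range_add, Finset.sum_eq_zero fun d hd => hm d (Finset.mem_range.1 hd), zero_add,
      map_sum, Finset.mul_sum]
    refine Finset.sum_congr rfl fun i _ => ?_
    rw [(homogeneousComponent_isHomogeneous _ _).eval_smul_eq, pow_add, mul_assoc]

theorem MvPolynomial.homogeneousComponent_totalDegree_ne_zero {σ R : Type*} [CommSemiring R]
    {f : MvPolynomial σ R} (hf : f ≠ 0) : homogeneousComponent f.totalDegree f ≠ 0 := by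
  obtain ⟨s, hs, hsd⟩ := Finset.exists_mem_eq_sup f.support (support_nonempty.2 hf)
    fun s => s.degree
  have hd : s.degree = f.totalDegree := hsd.symm
  intro h0
  have h1 := congrArg (coeff s) h0
  rw [coeff_homogeneousComponent, if_pos hd, coeff_zero] at h1
  exact mem_support_iff.1 hs h1

/-- Two nonzero binary forms have a common non-vanishing direction other than the first axis. -/
theorem MvPolynomial.exists_eval_ne_zero_and {F G : MvPolynomial (Fin 2) ℂ} {m n : ℕ}
    (hF : F.IsHomogeneous m) (hG : G.IsHomogeneous n) (hF0 : F ≠ 0) (hG0 : G ≠ 0) :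
    ∃ a : ℂ, eval ![a, 1] F ≠ 0 ∧ eval ![a, 1] G ≠ 0 := by
  have hne : F * G * X 1 ≠ 0 := mul_ne_zero (mul_ne_zero hF0 hG0) (X_ne_zero _)
  obtain ⟨v, hv⟩ : ∃ v, eval v (F * G * X 1) ≠ 0 := by
    by_contra! hcon
    exact hne (MvPolynomial.funext fun v => by rw [hcon v, map_zero])
  simp only [map_mul, eval_X, mul_ne_zero_iff] at hv
  have hvv : v = v 1 • ![v 0 / v 1, 1] := by
    ext i
    fin_cases i
    · simp [mul_div_cancel₀ _ hv.2]
    · simp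
  refine ⟨v 0 / v 1, fun h => hv.1.1 ?_, fun h => hv.1.2 ?_⟩
  · rw [hvv, hF.eval_smul_eq, h, mul_zero]
  · rw [hvv, hG.eval_smul_eq, h, mul_zero]

/-- The polynomial `f (x + a * y, y)` as a polynomial in `y` over `ℂ[x]`. -/
noncomputable def shear (a : ℂ) : MvPolynomial (Fin 2) ℂ →ₐ[ℂ] Polynomial (Polynomial ℂ) :=
  aeval ![Polynomial.C Polynomial.X + Polynomial.C (Polynomial.C a) * Polynomial.X, Polynomial.X]

theorem evalEval_shear (a x y : ℂ) (f : MvPolynomial (Fin 2) ℂ) :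
    (shear a f).evalEval x y = eval ![x + a * y, y] f := by
  have h : (Polynomial.evalEvalRingHom x y).comp (shear a).toRingHom = eval ![x + a * y, y] := by
    refine MvPolynomial.ringHom_ext (fun r => ?_) fun i => ?_
    · simp [shear, Polynomial.algebraMap_apply]
    · fin_cases i <;> simp [shear]
  exact DFunLike.congr_fun h f

theorem shear_squarefree (a : ℂ) {f : MvPolynomial (Fin 2) ℂ} (hf : Squarefree f) :
    Squarefree (shear a f) := by
  let ψ : Polynomial (Polynomial ℂ) →+* MvPolynomial (Fin 2) ℂ :=
    Polynomial.eval₂RingHom (Polynomial.eval₂RingHom C (X 0 - C a * X 1)) (X 1)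
  have h1 : ∀ g, ψ (shear a g) = g := by
    have h : ψ.comp (shear a).toRingHom = RingHom.id _ := by
      refine MvPolynomial.ringHom_ext (fun r => ?_) fun i => ?_
      · simp [shear, ψ, Polynomial.algebraMap_apply]
      · fin_cases i <;> simp [shear, ψ]
    exact fun g => DFunLike.congr_fun h g
  have h2 : ∀ q, shear a (ψ q) = q := by
    have h : (shear a).toRingHom.comp ψ = RingHom.id _ := by
      refine Polynomial.ringHom_ext' (Polynomial.ringHom_ext' ?_ ?_) ?_
      · ext r
        simp [shear, ψ, Polynomial.algebraMap_apply]
      · simp [shear, ψ, Polynomial.algebraMap_apply]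
      · simp [shear, ψ]
    exact fun q => DFunLike.congr_fun h q
  intro q hq
  have h3 := map_dvd ψ hq
  rw [map_mul, h1] at h3
  have h4 := (hf _ h3).map (shear a)
  rwa [h2] at h4

theorem shear_natDegree_le_and_coeff (a : ℂ) {f : MvPolynomial (Fin 2) ℂ} {n : ℕ}
    (hn : f.totalDegree ≤ n) : (shear a f).natDegree ≤ n ∧
      (shear a f).coeff n = Polynomial.C (eval ![a, 1] (homogeneousComponent n f)) := by
  have hterm : ∀ d ∈ f.support, (shear a (monomial d (coeff d f))).natDegree ≤ d.degree ∧
      (shear a (monomial d (coeff d f))).coeff d.degree =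
        Polynomial.C (eval ![a, 1] (monomial d (coeff d f))) := by
    intro d _
    set L : Polynomial (Polynomial ℂ) :=
      Polynomial.C Polynomial.X + Polynomial.C (Polynomial.C a) * Polynomial.X with hL
    have hLd : L.natDegree ≤ 1 := by
      rw [hL]; compute_degree
    have hLc : L.coeff 1 = Polynomial.C a := by
      rw [hL]; simp [Polynomial.coeff_C]
    have hs : shear a (monomial d (coeff d f)) =
        Polynomial.C (Polynomial.C (coeff d f)) * (L ^ d 0 * Polynomial.X ^ d 1) := by
      simp [shear, aeval_monomial, Finsupp.prod_fintype, Polynomial.algebraMap_apply, hL]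
    have hd : d.degree = d 0 + d 1 := by simp [Finsupp.degree_eq_sum]
    have hLp : (L ^ d 0).natDegree ≤ d 0 :=
      Polynomial.natDegree_pow_le_of_le (d 0) hLd |>.trans (by simp)
    have hLpc : (L ^ d 0).coeff (d 0) = Polynomial.C a ^ d 0 := by
      simpa [hLc] using Polynomial.coeff_pow_of_natDegree_le (m := d 0) hLd
    rw [hs, hd]
    constructor
    · refine (Polynomial.natDegree_C_mul_le _ _).trans (Polynomial.natDegree_mul_le_of_le hLp ?_)
      exact Polynomial.natDegree_X_pow_le _
    · rw [Polynomial.coeff_C_mul, Polynomial.coeff_mul_add_eq_of_natDegree_le hLp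
        (Polynomial.natDegree_X_pow_le _), hLpc]
      simp [eval_monomial, Finsupp.prod_fintype]
  have hle : ∀ d ∈ f.support, d.degree ≤ n := fun d hd => (le_totalDegree hd).trans hn
  have hsum : shear a f = ∑ d ∈ f.support, shear a (monomial d (coeff d f)) := by
    rw [← map_sum, support_sum_monomial_coeff]
  constructor
  · rw [hsum]
    exact Polynomial.natDegree_sum_le_of_forall_le _ _ fun d hd => (hterm d hd).1.trans (hle d hd)
  · rw [hsum, Polynomial.finsetSum_coeff, homogeneousComponent_apply, map_sum, map_sum,
      Finset.sum_filter]
    refine Finset.sum_congr rfl fun d hd => ?_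
    split_ifs with h
    · rw [← h, (hterm d hd).2]
    · exact Polynomial.coeff_eq_zero_of_natDegree_lt
        ((hterm d hd).1.trans_lt (lt_of_le_of_ne (hle d hd) h))

/-- A binary form not vanishing at `(a, 1)` has finitely many zeros on the line `(1 + a * z, z)`. -/
theorem MvPolynomial.IsHomogeneous.finite_zeros {F : MvPolynomial (Fin 2) ℂ} {m : ℕ}
    (hF : F.IsHomogeneous m) {a : ℂ} (ha : eval ![a, 1] F ≠ 0) :
    {z : ℂ | eval ![1 + a * z, z] F = 0}.Finite := by
  set P : Polynomial ℂ :=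
    MvPolynomial.aeval ![1 + Polynomial.C a * Polynomial.X, Polynomial.X] F
  have hPe : ∀ z, P.eval z = eval ![1 + a * z, z] F := by
    have h : ∀ z, (Polynomial.evalRingHom z).comp
        (MvPolynomial.aeval ![1 + Polynomial.C a * Polynomial.X, Polynomial.X] :
          MvPolynomial (Fin 2) ℂ →ₐ[ℂ] Polynomial ℂ).toRingHom = eval ![1 + a * z, z] := by
      refine fun z => MvPolynomial.ringHom_ext (fun r => ?_) fun i => ?_
      · simp
      · fin_cases i <;> simp
    exact fun z => DFunLike.congr_fun (h z) F
  have hP0 : P ≠ 0 := by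
    intro h0
    have h1 : ∀ u : ℂ, u ≠ 0 → eval ![u + a, 1] F = 0 := by
      intro u hu
      have h2 : ![1 + a * u⁻¹, u⁻¹] = u⁻¹ • ![u + a, 1] := by
        ext i
        fin_cases i
        · simp only [Fin.zero_eta, Matrix.cons_val_zero, Pi.smul_apply, smul_eq_mul]
          field_simp
        · simp
      have h3 := hPe u⁻¹
      rw [h0, Polynomial.eval_zero, h2, hF.eval_smul_eq, eq_comm, mul_eq_zero] at h3
      exact h3.resolve_left (pow_ne_zero m (inv_ne_zero hu))
    have hc : Continuous fun u : ℂ => eval ![u + a, 1] F :=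
      (MvPolynomial.continuous_eval F).comp (by fun_prop)
    have h2 : Tendsto (fun u : ℂ => eval ![u + a, 1] F) (𝓝[≠] 0) (𝓝 (eval ![0 + a, 1] F)) :=
      hc.continuousAt.tendsto.mono_left nhdsWithin_le_nhds
    rw [zero_add] at h2
    exact ha (tendsto_nhds_unique h2 (tendsto_const_nhds.congr'
      (eventually_nhdsWithin_of_forall fun u hu => (h1 u hu).symm)))
  refine (Polynomial.rootSet_finite P ℂ).subset fun z hz => ?_
  rw [Polynomial.mem_rootSet]
  exact ⟨hP0, by rw [Polynomial.coe_aeval_eq_eval, hPe]; exact hz⟩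

/-- In suitable linear coordinates a reduced plane curve through the origin is sheeted there, the
number of sheets being its multiplicity. -/
theorem MvPolynomial.exists_isSheeted {f : MvPolynomial (Fin 2) ℂ} (hf : Squarefree f)
    (hf0 : eval (0 : Fin 2 → ℂ) f = 0) :
    ∃ (a : ℂ) (Z : Fin (sInf {d : ℕ | homogeneousComponent d f ≠ 0}) → ℂ → ℂ)
      (t : Fin (sInf {d : ℕ | homogeneousComponent d f ≠ 0}) → ℂ),
      IsSheeted {q : ℂ × ℂ | eval ![q.1 + a * q.2, q.2] f = 0} Z t := by
  have hne : f ≠ 0 := hf.ne_zero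
  have hD := homogeneousComponent_totalDegree_ne_zero hne
  set m := sInf {d : ℕ | homogeneousComponent d f ≠ 0} with hm
  have hmf : homogeneousComponent m f ≠ 0 :=
    Nat.sInf_mem (s := {d : ℕ | homogeneousComponent d f ≠ 0}) ⟨_, hD⟩
  obtain ⟨Q, hQc, hQ0, hQ⟩ := exists_eval_smul_eq (f := f) (m := m) fun d hd =>
    not_not.1 (Nat.notMem_of_lt_sInf hd)
  obtain ⟨a, ham, haD⟩ := exists_eval_ne_zero_and (homogeneousComponent_isHomogeneous m f)
    (homogeneousComponent_isHomogeneous _ f) hmf hD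
  set c := eval ![a, 1] (homogeneousComponent f.totalDegree f) with hc
  obtain ⟨hdeg, hcoeff⟩ := shear_natDegree_le_and_coeff a (le_refl f.totalDegree)
  set p := Polynomial.C (Polynomial.C c⁻¹) * shear a f with hp
  have hpc : p.coeff f.totalDegree = 1 := by
    rw [hp, Polynomial.coeff_C_mul, hcoeff, ← Polynomial.C_mul, inv_mul_cancel₀ haD,
      Polynomial.C_1]
  have hpd : p.natDegree ≤ f.totalDegree := (Polynomial.natDegree_C_mul_le _ _).trans hdeg
  have hpm : p.Monic := Polynomial.monic_of_natDegree_le_of_coeff_eq_one _ hpd hpc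
  have hpos : 0 < p.natDegree := by
    rw [Polynomial.natDegree_eq_of_le_of_coeff_ne_zero hpd (by simp [hpc]), Nat.pos_iff_ne_zero]
    intro h0
    rw [totalDegree_eq_zero_iff_eq_C] at h0
    rw [h0, eval_C] at hf0
    exact hne (by rw [h0, hf0, C_0])
  have hpsq : Squarefree p := fun q hq => shear_squarefree a hf q
    (((Polynomial.isUnit_C.2 (Polynomial.isUnit_C.2
      (inv_ne_zero haD).isUnit)).dvd_mul_left).1 hq)
  have hpe : ∀ x y, p.evalEval x y = c⁻¹ * eval ![x + a * y, y] f := fun x y => by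
    rw [hp, Polynomial.evalEval_mul, evalEval_shear, Polynomial.evalEval_C, Polynomial.eval_C]
  have hQ₁ : ∀ u y, p.evalEval (u * y) y = y ^ m * (c⁻¹ * Q (y, ![u + a, 1])) := fun u y => by
    have h1 : ![u * y + a * y, y] = y • ![u + a, 1] := by
      ext i
      fin_cases i <;> simp [mul_comm, mul_add]
    rw [hpe, h1, hQ, mul_left_comm]
  have hQ₂ : ∀ x z, p.evalEval x (x * z) = x ^ m * (c⁻¹ * Q (x, ![1 + a * z, z])) := fun x z => by
    have h1 : ![x + a * (x * z), x * z] = x • ![1 + a * z, z] := by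
      ext i
      fin_cases i
      · simp
        ring
      · simp
    rw [hpe, h1, hQ, mul_left_comm]
  obtain ⟨Z, t, h⟩ := Polynomial.exists_isSheeted hpm hpsq hpos (m := m)
    (Q₁ := fun q => c⁻¹ * Q (q.2, ![q.1 + a, 1]))
    (Q₂ := fun q => c⁻¹ * Q (q.1, ![1 + a * q.2, q.2]))
    (by fun_prop) (by fun_prop) hQ₁ (by simpa [hQ0, haD] using ham) hQ₂
    (by simpa [hQ0, haD] using (homogeneousComponent_isHomogeneous m f).finite_zeros ham)
  refine ⟨a, Z, t, ?_⟩
  convert! h using 3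
  rw [hpe, mul_eq_zero, or_iff_right (inv_ne_zero haD)]

/-- The linear coordinates `(x + a * y, y)` of the plane. -/
noncomputable def shearEquiv (a : ℂ) : (ℂ × ℂ) ≃L[ℂ] EuclideanSpace ℂ (Fin 2) :=
  LinearEquiv.toContinuousLinearEquiv
    { toFun := fun q => !₂[q.1 + a * q.2, q.2]
      map_add' := fun q q' => by
        ext i
        fin_cases i
        · simp
          ring
        · simp
      map_smul' := fun c q => by
        ext i
        fin_cases i
        · simp
          ring
        · simp
      invFun := fun v => (v 0 - a * v 1, v 1)
      left_inv := fun q => by simp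
      right_inv := fun v => by
        ext i
        fin_cases i <;> simp }

/-- An outer bi-Lipschitz homeomorphism of germs, read in linear coordinates. -/
theorem OuterBiLipGerm.exists_lipschitzInverses {E F : Type*} [NormedAddCommGroup E]
    [NormedSpace ℂ E] [NormedAddCommGroup F] [NormedSpace ℂ F] {X : Set E} {Y : Set F}
    (h : OuterBiLipGerm X Y) (hX : (0 : E) ∈ X) (e : (ℂ × ℂ) ≃L[ℂ] E) (e' : (ℂ × ℂ) ≃L[ℂ] F) :
    ∃ ε > 0, ∃ δ > 0, ∃ φ ψ C, LipschitzInverses (e ⁻¹' (X ∩ Metric.closedBall 0 ε))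
      (e' ⁻¹' (Y ∩ Metric.closedBall 0 δ)) φ ψ C := by
  obtain ⟨ε, hε, δ, hδ, φ, hφ, hφ0, ⟨C, hC, hφC⟩, c, hc, hφc⟩ := h
  set S := X ∩ Metric.closedBall 0 ε
  set T := Y ∩ Metric.closedBall 0 δ
  have hinv := hφ.invOn_invFunOn
  set ψ := Function.invFunOn φ S
  have hψ : Set.MapsTo ψ T S := hφ.surjOn.mapsTo_invFunOn
  have hφL : LipschitzOnWith C.toNNReal φ S := LipschitzOnWith.of_dist_le_mul fun a ha b hb => by
    rw [Real.coe_toNNReal _ hC.le]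
    exact hφC a ha b hb
  have hψL : LipschitzOnWith c.toNNReal ψ T := LipschitzOnWith.of_dist_le_mul fun a ha b hb => by
    rw [Real.coe_toNNReal _ hc.le]
    simpa only [hinv.2 ha, hinv.2 hb] using hφc _ (hψ ha) _ (hψ hb)
  have hφL' := e'.symm.lipschitz.comp_lipschitzOnWith
    (hφL.comp (e.lipschitz.lipschitzOnWith (s := e ⁻¹' S)) fun _ ha => ha)
  have hψL' := e.symm.lipschitz.comp_lipschitzOnWith
    (hψL.comp (e'.lipschitz.lipschitzOnWith (s := e' ⁻¹' T)) fun _ ha => ha)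
  refine ⟨ε, hε, δ, hδ, _, _, _, ?_, ?_, ?_, ?_, ?_, ?_, hφL'.weaken (le_max_left _ _),
    hψL'.weaken (le_max_right _ _)⟩
  · intro a ha
    simpa [T] using hφ.mapsTo ha
  · intro b hb
    simpa [S] using hψ hb
  · intro a ha
    simp [hinv.1 ha]
  · intro b hb
    simp [hinv.2 hb]
  · simp [hX, hε.le]
  · simp [hφ0]

theorem IsSheeted.preimage_shearEquiv {ι : Type*} {f : MvPolynomial (Fin 2) ℂ} {a : ℂ}
    {Z : ι → ℂ → ℂ} {t : ι → ℂ} (h : IsSheeted {q : ℂ × ℂ | eval ![q.1 + a * q.2, q.2] f = 0} Z t)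
    {ε : ℝ} (hε : 0 < ε) :
    IsSheeted (shearEquiv a ⁻¹' (mvZeroSet f ∩ Metric.closedBall 0 ε)) Z t :=
  h.inter (U := shearEquiv a ⁻¹' Metric.closedBall 0 ε)
    ((shearEquiv a).continuous.continuousAt.preimage_mem_nhds
      (by simpa using Metric.closedBall_mem_nhds (0 : EuclideanSpace ℂ (Fin 2)) hε))

/-- multiplicity of complex plane curves is an outer bi-Lipschitz invariant
of the germ: if the germs `(V(f),0)` and `(V(g),0)` are outer bi-Lipschitz homeomorphic
then `ord₀ f = ord₀ g`. -/
theorem multiplicity_curves_biLipschitz_invariant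
    (f g : MvPolynomial (Fin 2) ℂ)
    (hfsqf : Squarefree f) (hgsqf : Squarefree g)
    (hf0 : MvPolynomial.eval (0 : Fin 2 → ℂ) f = 0)
    (hg0 : MvPolynomial.eval (0 : Fin 2 → ℂ) g = 0)
    (hbilip : OuterBiLipGerm (mvZeroSet f) (mvZeroSet g)) :
    sInf {d : ℕ | MvPolynomial.homogeneousComponent d f ≠ 0} =
      sInf {d : ℕ | MvPolynomial.homogeneousComponent d g ≠ 0} := by
  obtain ⟨a, Z, t, hZ⟩ := MvPolynomial.exists_isSheeted hfsqf hf0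
  obtain ⟨b, Z', t', hZ'⟩ := MvPolynomial.exists_isSheeted hgsqf hg0
  obtain ⟨ε, hε, δ, hδ, φ, ψ, C, h⟩ :=
    hbilip.exists_lipschitzInverses hf0 (shearEquiv a) (shearEquiv b)
  simpa using (hZ.preimage_shearEquiv hε).card_eq (hZ'.preimage_shearEquiv hδ) h
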